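/- Let G_0 = G_0(n) be any sequence of graphs on the vertex set {1,…,n} and let G_rand ∼ G(n,p) for some p = p_n ∈ [0,1/2] satisfying (1+(log n)^{-40})/n ≤ p ≤ 100·(log n)/n. Then with high probability G = G_0 △ G_rand satisfies the following property: for every pair of distinct vertices u, v for which there exists some i with |S^{≤i}_G({u,v})| ≥ 100·(log n)/min{(np−1)², 1}, the vertices u and v receive distinct colours in the stable colouring R*_G σ. -/

import Mathlib

open MeasureTheory Filter

/-- Product of (independent) Bernoulli distributions on `ι → Bool`, with
success probability `q i` in coordinate `i`. -/
noncomputable def bernoulliProduct (ι : Type*) [Fintype ι] [DecidableEq ι] (q : ι → ℝ) :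
    Measure (ι → Bool) :=
  ∑ f : ι → Bool,
    (∏ i : ι, if f i then ENNReal.ofReal (q i) else ENNReal.ofReal (1 - q i)) •
      Measure.dirac f

/-- The Erdős–Rényi measure: each (potential) edge of the complete graph on `Fin n`
is present independently with probability `p`; encoded as a random `Sym2 (Fin n) → Bool`. -/
noncomputable def erdosRenyiMeasure (n : ℕ) (p : ℝ) : Measure (Sym2 (Fin n) → Bool) :=
  bernoulliProduct (Sym2 (Fin n)) fun _ => p

/-- The graph on `Fin n` determined by an edge-indicator function. -/
def graphOfFlip {n : ℕ} (f : Sym2 (Fin n) → Bool) : SimpleGraph (Fin n) :=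
  SimpleGraph.fromRel fun u v => f s(u, v) = true

/-- Symmetric difference of two graphs on the same vertex set. -/
def symmDiffG {V : Type*} (G₁ G₂ : SimpleGraph V) : SimpleGraph V :=
  SimpleGraph.fromRel fun u v => Xor' (G₁.Adj u v) (G₂.Adj u v)

/-- `crEquiv G c t u v` : vertices `u` and `v` get the same colour after `t` rounds of
colour refinement on `G`, starting from the colouring `c`. -/
def crEquiv {V : Type*} {Ω : Type*} (G : SimpleGraph V) (c : V → Ω) : ℕ → V → V → Prop
  | 0, u, v => c u = c v
  | (t + 1), u, v => crEquiv G c t u v ∧ ∀ w : V,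
      Nat.card {x : V // G.Adj u x ∧ crEquiv G c t x w} =
      Nat.card {x : V // G.Adj v x ∧ crEquiv G c t x w}

/-- `u` and `v` get the same colour in the stable colouring `R* c`. -/
def crStable {V : Type*} {Ω : Type*} (G : SimpleGraph V) (c : V → Ω) (u v : V) : Prop :=
  ∀ t, crEquiv G c t u v

/-- `u` and `v` get the same colour in the stable colouring `R* σ`
(colour refinement started from the trivial colouring). -/
def crStableTrivial {V : Type*} (G : SimpleGraph V) (u v : V) : Prop :=
  crStable G (fun _ => (0 : ℕ)) u v

/-- Equality of the initial pair-colourings `φ_{G,c}` on two ordered pairs of vertices. -/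
def wl2Init {V : Type*} {Ω : Type*} (G : SimpleGraph V) (c : V → Ω) (p q : V × V) : Prop :=
  (G.Adj p.1 p.2 ↔ G.Adj q.1 q.2) ∧ (p.1 = p.2 ↔ q.1 = q.2) ∧
    (p.1 = p.2 → q.1 = q.2 → c p.2 = c q.2)

/-- `wl2Equiv G c t p q` : the ordered pairs `p` and `q` get the same colour after `t` rounds of
the 2-dimensional Weisfeiler–Leman refinement on `G`, started from `φ_{G,c}`. -/
def wl2Equiv {V : Type*} {Ω : Type*} (G : SimpleGraph V) (c : V → Ω) :
    ℕ → V × V → V × V → Prop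
  | 0, p, q => wl2Init G c p q
  | (t + 1), p, q => wl2Equiv G c t p q ∧ ∀ r s : V × V,
      Nat.card {w : V // wl2Equiv G c t (p.1, w) r ∧ wl2Equiv G c t (w, p.2) s} =
      Nat.card {w : V // wl2Equiv G c t (q.1, w) r ∧ wl2Equiv G c t (w, q.2) s}

/-- `u` and `v` get the same colour in the vertex colouring `V* c` obtained from the stable
pair colouring of the 2-dimensional Weisfeiler–Leman algorithm started from `φ_{G,c}`. -/
def wl2VertexEquiv {V : Type*} {Ω : Type*} (G : SimpleGraph V) (c : V → Ω) (u v : V) : Prop :=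
  ∀ t, wl2Equiv G c t (u, u) (v, v)

/-- Given a colouring of `V(H)` encoded as the equivalence relation `r` ("has the same colour"),
`majority H r u v` says that at least half of the possible edges between the colour class of `u`
and the colour class of `v` are present in `H` (counting ordered pairs). -/
def majority {V : Type*} (H : SimpleGraph V) (r : V → V → Prop) (u v : V) : Prop :=
  Nat.card {p : V × V // p.1 ≠ p.2 ∧ r p.1 u ∧ r p.2 v} ≤
    2 * Nat.card {p : V × V // p.1 ≠ p.2 ∧ r p.1 u ∧ r p.2 v ∧ H.Adj p.1 p.2}

/-- The disparity graph `D(H,c)`, for the colouring encoded by the relation `r`. -/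
def disparity {V : Type*} (H : SimpleGraph V) (r : V → V → Prop) : SimpleGraph V :=
  SimpleGraph.fromRel fun u v => Xor' (H.Adj u v) (majority H r u v)

/-- The generalised disparity graph `D_L(H,c)` for a 0-1 matrix `L` on colours. -/
def gDisparity {V : Type*} {Ω : Type*} (H : SimpleGraph V) (c : V → Ω) (L : Ω → Ω → Bool) :
    SimpleGraph V :=
  SimpleGraph.fromRel fun u v => Xor' (H.Adj u v) (L (c u) (c v) = true)

/-- The vertex set of the connected component of `v` in `G`. -/
def compSet {V : Type*} (G : SimpleGraph V) (v : V) : Set V := {u | G.Reachable v u}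

/-- A colouring is equitable if any two vertices with the same colour have the same number of
neighbours in every colour class. -/
def IsEquitable {V : Type*} {Ω : Type*} (H : SimpleGraph V) (c : V → Ω) : Prop :=
  ∀ u v, c u = c v → ∀ a : Ω,
    Nat.card {x : V // H.Adj u x ∧ c x = a} = Nat.card {x : V // H.Adj v x ∧ c x = a}

/-- Vertex set of the `k`-core of `G`: the union of all vertex sets inducing minimum
degree at least `k`. -/
def kCore {V : Type*} (G : SimpleGraph V) (k : ℕ) : Set V :=
  ⋃₀ {S : Set V | ∀ v ∈ S, k ≤ Nat.card {u : V // u ∈ S ∧ G.Adj v u}}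

/-- `V_{2,3}(G)`: vertices of the 2-core of `G` having degree at least 3 in the 2-core. -/
def V23 {V : Type*} (G : SimpleGraph V) : Set V :=
  {v | v ∈ kCore G 2 ∧ 3 ≤ Nat.card {u : V // u ∈ kCore G 2 ∧ G.Adj v u}}

/-- The graph obtained from `G` by deleting all edges meeting `T`
(so that reachability in `avoidG G T` from `v ∉ T` is reachability in `G - T`). -/
def avoidG {V : Type*} (G : SimpleGraph V) (T : Set V) : SimpleGraph V :=
  SimpleGraph.fromRel fun u v => G.Adj u v ∧ u ∉ T ∧ v ∉ T

/-- `V_{2,3}^{safe}(G)`: vertices `v ∈ V_{2,3}(G)` such that after deleting any set of at most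
two other vertices, the component of `v` still contains at least 3 vertices of `V_{2,3}(G)`. -/
def V23safe {V : Type*} (G : SimpleGraph V) : Set V :=
  {v | v ∈ V23 G ∧ ∀ T : Finset V, T.card ≤ 2 → v ∉ T →
    3 ≤ Nat.card {w : V // w ∈ V23 G ∧ (avoidG G (T : Set V)).Reachable v w}}

open Classical in
/-- `Lmul G i u v w` is the multiplicity of the vertex `w` in the multiset `L^i_G(u,v)`. -/
noncomputable def Lmul {V : Type*} [Fintype V] (G : SimpleGraph V) : ℕ → V → V → V → ℕ
  | 0, u, _, w => if w = u then 1 else 0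
  | (i + 1), u, v, w =>
      (∑ x : V, if G.Adj w x then Lmul G i u v x else 0) -
        (∑ x : V, if G.Adj w x then Lmul G i v u x else 0)

/-- Union over `j < i` of the supports of `L^j_G(u,v)` and `L^j_G(v,u)`. -/
noncomputable def Sbelow {V : Type*} [Fintype V] (G : SimpleGraph V) (u v : V) (i : ℕ) :
    Set V :=
  {w | ∃ j < i, 0 < Lmul G j u v w ∨ 0 < Lmul G j v u w}

/-- `S^{≤ i}_G({u,v})`. -/
noncomputable def Sle {V : Type*} [Fintype V] (G : SimpleGraph V) (u v : V) (i : ℕ) : Set V :=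
  Sbelow G u v (i + 1)

/-- `S^{i}_G({u,v}) = S^{≤ i}_G({u,v}) \ S^{≤ i-1}_G({u,v})`. -/
noncomputable def Sat {V : Type*} [Fintype V] (G : SimpleGraph V) (u v : V) (i : ℕ) : Set V :=
  Sbelow G u v (i + 1) \ Sbelow G u v i

/-- Degree of a vertex (as `Nat.card` of the neighbour set, avoiding decidability issues). -/
noncomputable def ncDegree {V : Type*} (G : SimpleGraph V) (v : V) : ℕ :=
  Nat.card {u : V // G.Adj v u}

/-- The random refinement of a colouring `c`: each vertex `v` with `f v = true` receives
a brand-new colour unique to itself. -/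
def refineColor {V : Type*} {Ω : Type*} (c : V → Ω) (f : V → Bool) : V → Ω ⊕ V :=
  fun v => if f v then Sum.inr v else Sum.inl (c v)

/-- `D(H,c)` (for the colouring encoded by the relation `r`) is `s`-bounded: every
intersection of a colour class with a connected component of `D(H,c)` has at most
`s` elements. -/
def sBounded {V : Type*} (H : SimpleGraph V) (r : V → V → Prop) (s : ℕ) : Prop :=
  ∀ u v : V, Nat.card {w : V // r w u ∧ w ∈ compSet (disparity H r) v} ≤ s

/-- The type of canonical colours after `t` rounds of colour refinement. -/
def CCol : ℕ → Type
  | 0 => Unit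
  | (t + 1) => CCol t × Multiset (CCol t)

open Classical in
/-- The canonical colour of a vertex after `t` rounds of colour refinement. -/
noncomputable def canonColor {V : Type*} [Fintype V] (G : SimpleGraph V) :
    (t : ℕ) → V → CCol t
  | 0, _ => ()
  | (t + 1), v =>
      (canonColor G t v, (Finset.univ.filter fun w => G.Adj v w).val.map (canonColor G t))

/-- The modal probability `M(m,p)` of a `Binomial(m,p)` random variable. -/
noncomputable def modalProb (m : ℕ) (p : ℝ) : ℝ :=
  (m.choose ⌊(m + 1 : ℝ) * p⌋₊ : ℝ) * p ^ ⌊(m + 1 : ℝ) * p⌋₊ *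
    (1 - p) ^ (m - ⌊(m + 1 : ℝ) * p⌋₊)


section BernoulliCube

variable {ι κ : Type*} [Fintype ι] [DecidableEq ι]

/-- The weight of `f` under independent Bernoulli trials with success probability `p`. -/
noncomputable def bernoulliWeight (p : ℝ) (f : ι → Bool) : ℝ := ∏ i, if f i then p else 1 - p

/-- The expectation of `φ` under independent Bernoulli trials with success probability `p`. -/
noncomputable def bernoulliExp (p : ℝ) (φ : (ι → Bool) → ℝ) : ℝ :=
  ∑ f : ι → Bool, bernoulliWeight p f * φ f

open Classical in
/-- The probability of the event `P` under independent Bernoulli trials. -/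
noncomputable def bernoulliProb (p : ℝ) (P : (ι → Bool) → Prop) : ℝ :=
  bernoulliExp p fun f => if P f then 1 else 0

open Classical in
/-- The configuration agreeing with `f` on `T` and with `g` off `T`. -/
noncomputable def splice (T : Set ι) (f g : ι → Bool) : ι → Bool :=
  fun i => if i ∈ T then f i else g i

/-- `φ` only depends on the coordinates in `I`. -/
def DependsOnCoords {α : Type*} (φ : (ι → Bool) → α) (I : Set ι) : Prop :=
  ∀ f g : ι → Bool, (∀ i ∈ I, f i = g i) → φ f = φ g

omit [Fintype ι] [DecidableEq ι] in
lemma splice_of_mem {T : Set ι} {f g : ι → Bool} {i : ι} (h : i ∈ T) : splice T f g i = f i := by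
  simp [splice, h]

omit [Fintype ι] [DecidableEq ι] in
lemma splice_of_notMem {T : Set ι} {f g : ι → Bool} {i : ι} (h : i ∉ T) :
    splice T f g i = g i := by
  simp [splice, h]

omit [DecidableEq ι] in
lemma bernoulliWeight_nonneg {p : ℝ} (h0 : 0 ≤ p) (h1 : p ≤ 1) (f : ι → Bool) :
    0 ≤ bernoulliWeight p f := by
  refine Finset.prod_nonneg fun i _ => ?_
  split_ifs <;> linarith

lemma sum_bernoulliWeight (p : ℝ) : ∑ f : ι → Bool, bernoulliWeight p f = 1 := by
  classical
  have h := (Finset.prod_univ_sum (fun _ : ι => (Finset.univ : Finset Bool))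
    (fun _ b => if b = true then p else 1 - p)).symm
  simp only [Fintype.piFinset_univ] at h
  unfold bernoulliWeight
  rw [h]
  simp

lemma bernoulliExp_const (p c : ℝ) : bernoulliExp p (fun _ : ι → Bool => c) = c := by
  rw [bernoulliExp, ← Finset.sum_mul, sum_bernoulliWeight, one_mul]

lemma bernoulliExp_mono {p : ℝ} (h0 : 0 ≤ p) (h1 : p ≤ 1) {φ ψ : (ι → Bool) → ℝ}
    (h : ∀ f, φ f ≤ ψ f) : bernoulliExp p φ ≤ bernoulliExp p ψ :=
  Finset.sum_le_sum fun f _ => mul_le_mul_of_nonneg_left (h f) (bernoulliWeight_nonneg h0 h1 f)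

lemma bernoulliExp_le_const {p : ℝ} (h0 : 0 ≤ p) (h1 : p ≤ 1) {φ : (ι → Bool) → ℝ} {c : ℝ}
    (h : ∀ f, φ f ≤ c) : bernoulliExp p φ ≤ c :=
  (bernoulliExp_mono h0 h1 h).trans (bernoulliExp_const p c).le

lemma bernoulliExp_const_mul (p c : ℝ) (φ : (ι → Bool) → ℝ) :
    bernoulliExp p (fun f => c * φ f) = c * bernoulliExp p φ := by
  simp only [bernoulliExp, Finset.mul_sum]
  exact Finset.sum_congr rfl fun f _ => by ring

lemma bernoulliExp_add (p : ℝ) (φ ψ : (ι → Bool) → ℝ) :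
    bernoulliExp p (fun f => φ f + ψ f) = bernoulliExp p φ + bernoulliExp p ψ := by
  simp only [bernoulliExp, ← Finset.sum_add_distrib, mul_add]

lemma bernoulliExp_sum (p : ℝ) (s : Finset κ) (φ : κ → (ι → Bool) → ℝ) :
    bernoulliExp p (fun f => ∑ k ∈ s, φ k f) = ∑ k ∈ s, bernoulliExp p (φ k) := by
  simp only [bernoulliExp, Finset.mul_sum]
  exact Finset.sum_comm

lemma bernoulliExp_comm {ι' : Type*} [Fintype ι'] [DecidableEq ι'] (p q : ℝ)
    (φ : (ι → Bool) → (ι' → Bool) → ℝ) :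
    bernoulliExp p (fun f => bernoulliExp q (φ f)) =
      bernoulliExp q (fun g => bernoulliExp p (fun f => φ f g)) := by
  simp only [bernoulliExp, Finset.mul_sum]
  rw [Finset.sum_comm]
  exact Finset.sum_congr rfl fun f _ => Finset.sum_congr rfl fun g _ => by ring

lemma bernoulliProb_eq (p : ℝ) (P : (ι → Bool) → Prop) [DecidablePred P] :
    bernoulliProb p P = bernoulliExp p fun f => if P f then 1 else 0 := by
  unfold bernoulliProb
  congr! 

lemma bernoulliProb_nonneg {p : ℝ} (h0 : 0 ≤ p) (h1 : p ≤ 1) (P : (ι → Bool) → Prop) :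
    0 ≤ bernoulliProb p P :=
  Finset.sum_nonneg fun f _ => mul_nonneg (bernoulliWeight_nonneg h0 h1 f)
    (by dsimp only; split_ifs <;> simp)

lemma bernoulliProb_mono {p : ℝ} (h0 : 0 ≤ p) (h1 : p ≤ 1) {P Q : (ι → Bool) → Prop}
    (h : ∀ f, P f → Q f) : bernoulliProb p P ≤ bernoulliProb p Q := by
  refine bernoulliExp_mono h0 h1 fun f => ?_
  by_cases hP : P f
  · simp [hP, h f hP]
  · simp only [hP, if_false]
    split_ifs <;> simp

lemma bernoulliProb_exists_le {p : ℝ} (h0 : 0 ≤ p) (h1 : p ≤ 1) (s : Finset κ)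
    (P : κ → (ι → Bool) → Prop) :
    bernoulliProb p (fun f => ∃ k ∈ s, P k f) ≤ ∑ k ∈ s, bernoulliProb p (P k) := by
  classical
  unfold bernoulliProb
  rw [← bernoulliExp_sum]
  refine bernoulliExp_mono h0 h1 fun f => ?_
  split_ifs with h
  · obtain ⟨k, hk, hP⟩ := h
    calc (1 : ℝ) = if P k f then 1 else 0 := by simp [hP]
      _ ≤ _ := Finset.single_le_sum (f := fun k => if P k f then (1 : ℝ) else 0)
        (fun i _ => by split_ifs <;> simp) hk
  · exact Finset.sum_nonneg fun i _ => by split_ifs <;> simp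

lemma bernoulliProb_or_le {p : ℝ} (h0 : 0 ≤ p) (h1 : p ≤ 1) (P Q : (ι → Bool) → Prop) :
    bernoulliProb p (fun f => P f ∨ Q f) ≤ bernoulliProb p P + bernoulliProb p Q := by
  classical
  unfold bernoulliProb
  rw [← bernoulliExp_add]
  refine bernoulliExp_mono h0 h1 fun f => ?_
  by_cases hP : P f <;> by_cases hQ : Q f <;> simp [hP, hQ]

/-- Resampling all coordinates outside a self-determined set of coordinates
does not change the distribution. -/
lemma bernoulliExp_resample (p : ℝ) (F : (ι → Bool) → Set ι)
    (hF : ∀ f g : ι → Bool, (∀ i ∈ F f, g i = f i) → F g = F f) (φ : (ι → Bool) → ℝ) :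
    bernoulliExp p φ =
      bernoulliExp p fun f => bernoulliExp p fun g => φ (splice (F f) f g) := by
  classical
  have hsp : ∀ f g : ι → Bool, F (splice (F f) f g) = F f := fun f g =>
    hF _ _ fun i hi => splice_of_mem hi
  let Θ : (ι → Bool) × (ι → Bool) → (ι → Bool) × (ι → Bool) := fun q =>
    (splice (F q.1) q.1 q.2, splice (F q.1) q.2 q.1)
  have hΘ : Function.Involutive Θ := by
    rintro ⟨f, g⟩
    simp only [Θ, hsp]
    refine Prod.ext ?_ ?_ <;> funext i <;> by_cases h : i ∈ F f <;> simp [splice, h]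
  have hw : ∀ q : (ι → Bool) × (ι → Bool),
      bernoulliWeight p (Θ q).1 * bernoulliWeight p (Θ q).2 =
        bernoulliWeight p q.1 * bernoulliWeight p q.2 := by
    rintro ⟨f, g⟩
    simp only [bernoulliWeight, Θ, ← Finset.prod_mul_distrib]
    refine Finset.prod_congr rfl fun i _ => ?_
    by_cases h : i ∈ F f
    · simp [splice, h]
    · simp only [splice, h, if_false]
      ring
  have h1 : bernoulliExp p φ = ∑ q : (ι → Bool) × (ι → Bool),
      bernoulliWeight p q.1 * bernoulliWeight p q.2 * φ q.1 := by
    rw [Fintype.sum_prod_type]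
    refine Finset.sum_congr rfl fun f _ => ?_
    calc bernoulliWeight p f * φ f
        = bernoulliWeight p f * φ f * ∑ g : ι → Bool, bernoulliWeight p g := by
          rw [sum_bernoulliWeight, mul_one]
      _ = _ := by
          rw [Finset.mul_sum]
          exact Finset.sum_congr rfl fun g _ => by ring
  rw [h1, ← Equiv.sum_comp hΘ.toPerm, Fintype.sum_prod_type]
  refine Finset.sum_congr rfl fun f _ => ?_
  simp only [bernoulliExp, Finset.mul_sum]
  refine Finset.sum_congr rfl fun g _ => ?_
  have := hw (f, g)
  simp only [Function.Involutive.coe_toPerm]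
  rw [this]
  simp only [Θ]
  ring

/-- Permuting the coordinates does not change the distribution. -/
lemma bernoulliExp_comp_perm (p : ℝ) (e : Equiv.Perm ι) (φ : (ι → Bool) → ℝ) :
    bernoulliExp p (fun f => φ (f ∘ e)) = bernoulliExp p φ := by
  unfold bernoulliExp
  rw [← Equiv.sum_comp (e.arrowCongr (Equiv.refl Bool))]
  refine Finset.sum_congr rfl fun f _ => ?_
  have : (e.arrowCongr (Equiv.refl Bool)) f ∘ e = f := by
    funext i; simp [Equiv.arrowCongr]
  beta_reduce
  rw [this]
  congr 1
  unfold bernoulliWeight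
  rw [← Equiv.prod_comp e]
  refine Finset.prod_congr rfl fun i _ => by simp [Equiv.arrowCongr]

lemma bernoulliExp_mul_of_disjoint (p : ℝ) {φ ψ : (ι → Bool) → ℝ} {I J : Set ι}
    (hIJ : Disjoint I J) (hφ : DependsOnCoords φ I) (hψ : DependsOnCoords ψ J) :
    bernoulliExp p (fun f => φ f * ψ f) = bernoulliExp p φ * bernoulliExp p ψ := by
  rw [bernoulliExp_resample p (fun _ => I) (fun _ _ _ => rfl)]
  have : ∀ f g : ι → Bool, φ (splice I f g) * ψ (splice I f g) = φ f * ψ g := by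
    intro f g
    rw [hφ (splice I f g) f fun i hi => splice_of_mem hi,
      hψ (splice I f g) g fun i hi => splice_of_notMem (Set.disjoint_right.1 hIJ hi)]
  simp only [this, bernoulliExp_const_mul]
  simp only [bernoulliExp, Finset.sum_mul]
  exact Finset.sum_congr rfl fun f _ => by ring

lemma bernoulliExp_prod_of_disjoint (p : ℝ) (s : Finset κ) (φ : κ → (ι → Bool) → ℝ)
    (I : κ → Set ι) (hI : ∀ k ∈ s, ∀ l ∈ s, k ≠ l → Disjoint (I k) (I l))
    (hφ : ∀ k ∈ s, DependsOnCoords (φ k) (I k)) :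
    bernoulliExp p (fun f => ∏ k ∈ s, φ k f) = ∏ k ∈ s, bernoulliExp p (φ k) := by
  classical
  induction s using Finset.induction_on with
  | empty => simp [bernoulliExp_const]
  | insert a s ha ih =>
    simp only [Finset.prod_insert ha]
    rw [bernoulliExp_mul_of_disjoint p (I := I a) (J := ⋃ k ∈ s, I k), ih]
    · exact fun k hk l hl => hI k (Finset.mem_insert_of_mem hk) l (Finset.mem_insert_of_mem hl)
    · exact fun k hk => hφ k (Finset.mem_insert_of_mem hk)
    · refine Set.disjoint_iUnion₂_right.2 fun k hk => ?_
      exact hI a (Finset.mem_insert_self _ _) k (Finset.mem_insert_of_mem hk)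
        (fun h => ha (h ▸ hk))
    · exact hφ a (Finset.mem_insert_self _ _)
    · intro f g hfg
      refine Finset.prod_congr rfl fun k hk => ?_
      exact hφ k (Finset.mem_insert_of_mem hk) f g fun i hi =>
        hfg i (Set.mem_iUnion₂.2 ⟨k, hk, hi⟩)

lemma bernoulliExp_coord (p a b : ℝ) (i : ι) :
    bernoulliExp p (fun f => if f i then a else b) = p * a + (1 - p) * b := by
  classical
  have key : ∀ c : ι → Bool → ℝ, ∑ f : ι → Bool, ∏ j, c j (f j) = ∏ j, ∑ b, c j b := by
    intro c
    have h := (Finset.prod_univ_sum (fun _ : ι => (Finset.univ : Finset Bool)) c).symm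
    simpa only [Fintype.piFinset_univ] using h
  have h2 : ∀ f : ι → Bool, bernoulliWeight p f * (if f i then a else b) =
      ∏ j, ((if f j then p else 1 - p) * if j = i then (if f j then a else b) else 1) := by
    intro f
    rw [Finset.prod_mul_distrib, bernoulliWeight]
    congr 1
    rw [Finset.prod_ite_eq' Finset.univ i]
    simp
  unfold bernoulliExp
  simp only [h2]
  rw [key (fun j x => (if x = true then p else 1 - p) * if j = i then (if x = true then a else b)
    else 1), Finset.prod_eq_single i]
  · simp
  · intro j _ hj
    simp [hj]
  · simp

/-- The probability that the pattern on `Y` is exactly the indicator of `Q ⊆ Y`. -/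
lemma bernoulliProb_pattern (p : ℝ) (Y Q : Finset ι) (hQ : Q ⊆ Y) :
    bernoulliProb p (fun f => ∀ i ∈ Y, (f i = true ↔ i ∈ Q)) =
      p ^ Q.card * (1 - p) ^ (Y.card - Q.card) := by
  classical
  have h1 : ∀ f : ι → Bool, (if ∀ i ∈ Y, (f i = true ↔ i ∈ Q) then (1 : ℝ) else 0) =
      ∏ i ∈ Y, if f i then (if i ∈ Q then (1 : ℝ) else 0) else (if i ∈ Q then 0 else 1) := by
    intro f
    split_ifs with h
    · refine (Finset.prod_eq_one fun i hi => ?_).symm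
      have := h i hi
      by_cases h1 : i ∈ Q <;> simp_all
    · push Not at h
      obtain ⟨i, hi, hh⟩ := h
      refine (Finset.prod_eq_zero hi ?_).symm
      rcases hh with hh | hh <;> simp [hh.1, hh.2]
  rw [bernoulliProb_eq]
  simp only [h1]
  rw [bernoulliExp_prod_of_disjoint p Y _ (fun i => {i})]
  · simp only [bernoulliExp_coord]
    rw [← Finset.prod_sdiff hQ, mul_comm]
    congr 1
    · rw [Finset.prod_congr rfl (g := fun _ => p)]
      · simp
      · intro i hi; simp [hi]
    · rw [Finset.prod_congr rfl (g := fun _ => 1 - p)]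
      · simp [Finset.card_sdiff_of_subset hQ]
      · intro i hi
        simp [(Finset.mem_sdiff.1 hi).2]
  · intro k _ l _ h
    simpa using h
  · intro k _ f g hfg
    simp [hfg k rfl]

/-- The binomial formula for the number of successes among the coordinates in `Y`. -/
lemma bernoulliProb_card_eq (p : ℝ) (Y : Finset ι) (a : ℕ) :
    bernoulliProb p (fun f => (Y.filter fun i => f i = true).card = a) =
      Y.card.choose a * p ^ a * (1 - p) ^ (Y.card - a) := by
  classical
  have h1 : ∀ f : ι → Bool, (if (Y.filter fun i => f i = true).card = a then (1 : ℝ) else 0) =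
      ∑ Q ∈ Y.powersetCard a, if ∀ i ∈ Y, (f i = true ↔ i ∈ Q) then (1 : ℝ) else 0 := by
    intro f
    have h2 : ∀ Q ∈ Y.powersetCard a,
        ((∀ i ∈ Y, (f i = true ↔ i ∈ Q)) ↔ Q = Y.filter fun i => f i = true) := by
      intro Q hQ
      have hQ' := (Finset.mem_powersetCard.1 hQ).1
      constructor
      · intro h
        ext i
        simp only [Finset.mem_filter]
        exact ⟨fun hi => ⟨hQ' hi, (h i (hQ' hi)).2 hi⟩, fun hi => (h i hi.1).1 hi.2⟩
      · rintro rfl i hi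
        simp [hi]
    rw [Finset.sum_congr rfl fun Q hQ => by rw [if_congr (h2 Q hQ) rfl rfl]]
    rw [Finset.sum_ite_eq']
    refine if_congr ?_ rfl rfl
    simp [Finset.mem_powersetCard]
  rw [bernoulliProb_eq]
  simp only [h1]
  rw [bernoulliExp_sum]
  rw [Finset.sum_congr rfl (g := fun _ => p ^ a * (1 - p) ^ (Y.card - a))]
  · simp [mul_assoc]
  · intro Q hQ
    obtain ⟨hs, hc⟩ := Finset.mem_powersetCard.1 hQ
    have := bernoulliProb_pattern p Y Q hs
    rwa [hc, bernoulliProb_eq] at this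

lemma bernoulliExp_exp_neg_indicator_le {p : ℝ} (θ q : ℝ) (hθ : 0 ≤ θ)
    (P : (ι → Bool) → Prop) [DecidablePred P] (hq : q ≤ bernoulliProb p P) :
    bernoulliExp p (fun f => Real.exp (-θ * if P f then 1 else 0)) ≤
      Real.exp (-((1 - Real.exp (-θ)) * q)) := by
  classical
  have h1 : ∀ f, Real.exp (-θ * if P f then 1 else 0) =
      1 + (-(1 - Real.exp (-θ))) * (if P f then 1 else 0) := by
    intro f; split_ifs <;> simp
  simp only [h1]
  rw [bernoulliExp_add, bernoulliExp_const, bernoulliExp_const_mul]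
  have h2 : bernoulliExp p (fun f => if P f then (1 : ℝ) else 0) = bernoulliProb p P := by
    rw [bernoulliProb_eq]
  rw [h2]
  have h3 : 0 ≤ 1 - Real.exp (-θ) := by
    have := Real.exp_le_one_iff.2 (neg_nonpos.2 hθ); linarith
  have h4 := Real.add_one_le_exp (-((1 - Real.exp (-θ)) * q))
  nlinarith [mul_le_mul_of_nonneg_left hq h3]

/-- Exponential moment bound for a count of independent events. -/
lemma bernoulliExp_exp_neg_count_le {p : ℝ} (h0 : 0 ≤ p) (h1 : p ≤ 1) (θ q : ℝ) (hθ : 0 ≤ θ)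
    (s : Finset κ) (P : κ → (ι → Bool) → Prop) [∀ k, DecidablePred (P k)] (I : κ → Set ι)
    (hI : ∀ k ∈ s, ∀ l ∈ s, k ≠ l → Disjoint (I k) (I l))
    (hP : ∀ k ∈ s, DependsOnCoords (P k) (I k)) (hq : ∀ k ∈ s, q ≤ bernoulliProb p (P k)) :
    bernoulliExp p (fun f => Real.exp (-θ * (s.filter fun k => P k f).card)) ≤
      Real.exp (-((1 - Real.exp (-θ)) * (s.card * q))) := by
  have e1 : ∀ f : ι → Bool, Real.exp (-θ * (s.filter fun k => P k f).card) =
      ∏ k ∈ s, Real.exp (-θ * if P k f then 1 else 0) := by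
    intro f
    rw [← Real.exp_sum, ← Finset.mul_sum, Finset.sum_boole]
  simp only [e1]
  rw [bernoulliExp_prod_of_disjoint p s _ I hI]
  · calc _ ≤ ∏ k ∈ s, Real.exp (-((1 - Real.exp (-θ)) * q)) := by
          refine Finset.prod_le_prod (fun k _ => ?_) fun k hk =>
            bernoulliExp_exp_neg_indicator_le θ q hθ (P k) (hq k hk)
          exact Finset.sum_nonneg fun f _ =>
            mul_nonneg (bernoulliWeight_nonneg h0 h1 f) (Real.exp_nonneg _)
      _ = _ := by
          rw [Finset.prod_const, ← Real.exp_nat_mul]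
          congr 1
          ring
  · intro k hk f g hfg
    have := hP k hk f g hfg
    simp only [this]

lemma bernoulliProb_le_of_exp {p : ℝ} (h0 : 0 ≤ p) (h1 : p ≤ 1) {P : (ι → Bool) → Prop}
    {φ : (ι → Bool) → ℝ} (c : ℝ) (hφ : ∀ f, 0 ≤ φ f) (h : ∀ f, P f → 1 ≤ c * φ f)
    (hc : 0 ≤ c) : bernoulliProb p P ≤ c * bernoulliExp p φ := by
  rw [← bernoulliExp_const_mul]
  refine bernoulliExp_mono h0 h1 fun f => ?_
  split_ifs with hf
  · exact h f hf
  · exact mul_nonneg hc (hφ f)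

end BernoulliCube

section WalkDifference

variable {V : Type*}

lemma crEquiv_equivalence {Ω : Type*} (G : SimpleGraph V) (c : V → Ω) (t : ℕ) :
    Equivalence (crEquiv G c t) := by
  induction t with
  | zero => exact ⟨fun _ => rfl, fun h => h.symm, fun h h' => h.trans h'⟩
  | succ t ih =>
    exact ⟨fun x => ⟨ih.refl x, fun _ => rfl⟩, fun h => ⟨ih.symm h.1, fun w => (h.2 w).symm⟩,
      fun h h' => ⟨ih.trans h.1 h'.1, fun w => (h.2 w).trans (h'.2 w)⟩⟩

variable [Fintype V]

open Classical in
/-- The number of neighbours of `w` in `G`. -/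
noncomputable def neighborCount (G : SimpleGraph V) (w : V) : ℕ :=
  (Finset.univ.filter fun x => G.Adj w x).card

open Classical in
/-- The adjacency operator of `G` acting on integer-valued functions. -/
noncomputable def adjOp (G : SimpleGraph V) (g : V → ℤ) (w : V) : ℤ :=
  ∑ x, if G.Adj w x then g x else 0

open Classical in
/-- `walkDiff G u v i w` is the number of walks of length `i` from `u` to `w`, minus the number
of such walks from `v` to `w`. -/
noncomputable def walkDiff (G : SimpleGraph V) (u v : V) : ℕ → V → ℤ
  | 0 => fun w => (if w = u then 1 else 0) - (if w = v then 1 else 0)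
  | (i + 1) => adjOp G (walkDiff G u v i)

lemma adjOp_one (G : SimpleGraph V) (w : V) : adjOp G (fun _ => 1) w = neighborCount G w := by
  simp [adjOp, neighborCount]

lemma adjOp_symm (G : SimpleGraph V) (f g : V → ℤ) :
    ∑ w, adjOp G f w * g w = ∑ w, f w * adjOp G g w := by
  classical
  simp only [adjOp, Finset.sum_mul, Finset.mul_sum]
  rw [Finset.sum_comm]
  refine Finset.sum_congr rfl fun x _ => Finset.sum_congr rfl fun y _ => ?_
  simp [G.adj_comm x y]

lemma sum_walkDiff_mul (G : SimpleGraph V) (u v : V) (i : ℕ) (g : V → ℤ) :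
    ∑ w, walkDiff G u v i w * g w = (adjOp G)^[i] g u - (adjOp G)^[i] g v := by
  induction i generalizing g with
  | zero =>
    classical
    have h : ∀ y : V, ∑ w, (if w = y then 1 else 0) * g w = g y := fun y => by simp
    simp only [walkDiff, sub_mul, Finset.sum_sub_distrib, Function.iterate_zero, id_eq]
    convert congrArg₂ (· - ·) (h u) (h v)
  | succ i ih =>
    rw [walkDiff, adjOp_symm, ih, Function.iterate_succ_apply]

/-- Applying the adjacency operator to a function constant on the colour classes after `t` rounds
gives a function constant on the colour classes after `t + 1` rounds. -/
lemma adjOp_eq_of_crEquiv_succ {Ω : Type*} (G : SimpleGraph V) (c : V → Ω) (t : ℕ) (g : V → ℤ)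
    (hg : ∀ x y, crEquiv G c t x y → g x = g y) (x y : V) (h : crEquiv G c (t + 1) x y) :
    adjOp G g x = adjOp G g y := by
  classical
  let s : Setoid V := ⟨crEquiv G c t, crEquiv_equivalence G c t⟩
  have key : ∀ z : V, adjOp G g z = ∑ q : Quotient s,
      (Nat.card {a : V // G.Adj z a ∧ crEquiv G c t a q.out} : ℤ) * g q.out := by
    intro z
    unfold adjOp
    rw [← Finset.sum_fiberwise (s := Finset.univ) (g := fun a : V => (Quotient.mk s a))]
    refine Finset.sum_congr rfl fun q _ => ?_
    rw [← Finset.sum_filter, Finset.filter_filter, Nat.card_eq_fintype_card, Fintype.card_subtype]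
    have hq : ∀ a : V, Quotient.mk s a = q ↔ crEquiv G c t a q.out := by
      intro a
      rw [← Quotient.out_eq q, Quotient.eq, Quotient.out_eq]
      rfl
    rw [Finset.sum_congr (s₂ := Finset.univ.filter fun a => G.Adj z a ∧ crEquiv G c t a q.out)
      (g := fun _ => g q.out)]
    · simp
    · ext a; simp [hq, and_comm]
    · intro a ha
      simp only [Finset.mem_filter] at ha
      exact hg _ _ ha.2.2
  rw [key, key]
  refine Finset.sum_congr rfl fun q _ => ?_
  rw [h.2 q.out]

/-- If `u` and `v` receive the same stable colour, then the walk differences are orthogonal to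
every function of the degree. -/
lemma sum_walkDiff_neighborCount {G : SimpleGraph V} {u v : V} (h : crStableTrivial G u v)
    (i : ℕ) (F : ℕ → ℤ) : ∑ w, walkDiff G u v i w * F (neighborCount G w) = 0 := by
  have h1 : ∀ x y, crEquiv G (fun _ => (0 : ℕ)) 1 x y →
      F (neighborCount G x) = F (neighborCount G y) := by
    intro x y hxy
    have := adjOp_eq_of_crEquiv_succ G (fun _ => (0 : ℕ)) 0 (fun _ => 1) (fun _ _ _ => rfl) x y hxy
    rw [adjOp_one, adjOp_one] at this
    rw [Nat.cast_injective this]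
  have h2 : ∀ (j t : ℕ) (g : V → ℤ),
      (∀ x y, crEquiv G (fun _ => (0 : ℕ)) t x y → g x = g y) →
      ∀ x y, crEquiv G (fun _ => (0 : ℕ)) (t + j) x y →
        (adjOp G)^[j] g x = (adjOp G)^[j] g y := by
    intro j
    induction j with
    | zero => intro t g hg; simpa using hg
    | succ j ih =>
      intro t g hg x y hxy
      rw [Function.iterate_succ_apply]
      refine ih (t + 1) _ (adjOp_eq_of_crEquiv_succ G _ t g hg) x y ?_
      rwa [add_assoc, add_comm 1 j]
  rw [sum_walkDiff_mul, sub_eq_zero]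
  exact h2 i 1 _ h1 u v (h _)

lemma Lmul_eq_toNat (G : SimpleGraph V) {u v : V} (huv : u ≠ v) (i : ℕ) (w : V) :
    Lmul G i u v w = (walkDiff G u v i w).toNat ∧
      Lmul G i v u w = (-walkDiff G u v i w).toNat := by
  classical
  induction i generalizing w with
  | zero =>
    simp only [Lmul, walkDiff]
    by_cases h1 : w = u
    · subst h1; simp [huv]
    · by_cases h2 : w = v
      · subst h2; simp [h1]
      · simp [h1, h2]
  | succ i ih =>
    have e : walkDiff G u v (i + 1) w =
        ((∑ x : V, if G.Adj w x then Lmul G i u v x else 0 : ℕ) : ℤ) -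
          ((∑ x : V, if G.Adj w x then Lmul G i v u x else 0 : ℕ) : ℤ) := by
      push_cast
      rw [← Finset.sum_sub_distrib]
      simp only [walkDiff, adjOp]
      refine Finset.sum_congr rfl fun x _ => ?_
      split_ifs
      · rw [(ih x).1, (ih x).2]; omega
      · simp
    simp only [Lmul]
    rw [e]
    constructor <;> omega

lemma mem_Sbelow_iff (G : SimpleGraph V) {u v : V} (huv : u ≠ v) (i : ℕ) (w : V) :
    w ∈ Sbelow G u v i ↔ ∃ j < i, walkDiff G u v j w ≠ 0 := by
  simp only [Sbelow, Set.mem_ofPred_eq]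
  refine exists_congr fun j => and_congr_right fun _ => ?_
  rw [(Lmul_eq_toNat G huv j w).1, (Lmul_eq_toNat G huv j w).2]
  omega

lemma Sbelow_mono (G : SimpleGraph V) (u v : V) {i j : ℕ} (h : i ≤ j) :
    Sbelow G u v i ⊆ Sbelow G u v j := fun _ ⟨k, hk, hw⟩ => ⟨k, hk.trans_le h, hw⟩

lemma mem_Sat_iff (G : SimpleGraph V) {u v : V} (huv : u ≠ v) (i : ℕ) (w : V) :
    w ∈ Sat G u v i ↔ w ∉ Sbelow G u v i ∧ walkDiff G u v i w ≠ 0 := by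
  simp only [Sat, Set.mem_sdiff, mem_Sbelow_iff G huv]
  constructor
  · rintro ⟨⟨j, hj, hw⟩, h⟩
    refine ⟨h, ?_⟩
    rcases Nat.lt_succ_iff_lt_or_eq.1 hj with h1 | rfl
    · exact absurd ⟨j, h1, hw⟩ h
    · exact hw
  · rintro ⟨h, hw⟩
    exact ⟨⟨i, Nat.lt_succ_self i, hw⟩, h⟩

lemma walkDiff_eq_zero_of_notMem (G : SimpleGraph V) {u v : V} (huv : u ≠ v) {i j : ℕ}
    (hj : j < i) {w : V} (hw : w ∉ Sbelow G u v i) : walkDiff G u v j w = 0 := by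
  by_contra h
  exact hw ((mem_Sbelow_iff G huv i w).2 ⟨j, hj, h⟩)

lemma ncard_Sbelow_succ (G : SimpleGraph V) (u v : V) (i : ℕ) :
    (Sbelow G u v (i + 1)).ncard = (Sbelow G u v i).ncard + (Sat G u v i).ncard := by
  have h := Set.ncard_sdiff_add_ncard_of_subset (Sbelow_mono G u v (Nat.le_succ i))
  rw [Sat, ← h, add_comm]

/-- By the Cayley–Hamilton theorem, the supports stabilise after `|V|` steps. -/
lemma Sbelow_subset_card (G : SimpleGraph V) {u v : V} (huv : u ≠ v) (i : ℕ) :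
    Sbelow G u v i ⊆ Sbelow G u v (Fintype.card V) := by
  classical
  intro w hw
  by_contra hcon
  obtain ⟨k, -, hk⟩ := (mem_Sbelow_iff G huv i w).1 hw
  have hz : ∀ j < Fintype.card V, walkDiff G u v j w = 0 := fun j hj =>
    walkDiff_eq_zero_of_notMem G huv hj hcon
  let M : Matrix V V ℤ := fun a b => if G.Adj a b then 1 else 0
  have hM : ∀ j, walkDiff G u v j = (M ^ j).mulVec (walkDiff G u v 0) := by
    intro j
    induction j with
    | zero => simp
    | succ j ih =>
      rw [pow_succ', ← Matrix.mulVec_mulVec, ← ih]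
      funext a
      simp [walkDiff, adjOp, M, Matrix.mulVec, dotProduct]
  have hne : Nonempty V := ⟨w⟩
  have hdeg : (Polynomial.X ^ k %ₘ M.charpoly).natDegree < Fintype.card V := by
    have := Polynomial.natDegree_modByMonic_lt (Polynomial.X ^ k : Polynomial ℤ)
      M.charpoly_monic (by
        intro h
        have h1 := M.charpoly_natDegree_eq_dim
        rw [h] at h1
        simp at h1
        exact Fintype.card_ne_zero h1.symm)
    rwa [M.charpoly_natDegree_eq_dim] at this
  apply hk
  rw [hM, Matrix.pow_eq_aeval_mod_charpoly, Polynomial.aeval_eq_sum_range' hdeg,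
    Matrix.sum_mulVec, Finset.sum_apply]
  refine Finset.sum_eq_zero fun j hj => ?_
  rw [Matrix.smul_mulVec, ← hM, Pi.smul_apply, hz j (Finset.mem_range.1 hj), smul_zero]

/-- The first walk differences only depend on the edges touching the explored vertices. -/
lemma walkDiff_congr {G H : SimpleGraph V} {u v : V} (huv : u ≠ v) (i : ℕ)
    (h : ∀ x ∈ Sbelow G u v i, ∀ w, G.Adj w x ↔ H.Adj w x) (j : ℕ) (hj : j ≤ i) :
    walkDiff H u v j = walkDiff G u v j := by
  classical
  induction j with
  | zero => rfl
  | succ j ih =>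
    simp only [walkDiff]
    rw [ih (Nat.le_of_succ_le hj)]
    funext w
    refine Finset.sum_congr rfl fun x _ => ?_
    by_cases hx : x ∈ Sbelow G u v i
    · simp only [h x hx w]
    · simp [walkDiff_eq_zero_of_notMem G huv (Nat.lt_of_succ_le hj) hx]

lemma Sbelow_congr {G H : SimpleGraph V} {u v : V} (huv : u ≠ v) (i : ℕ)
    (h : ∀ x ∈ Sbelow G u v i, ∀ w, G.Adj w x ↔ H.Adj w x) (j : ℕ) (hj : j ≤ i + 1) :
    Sbelow H u v j = Sbelow G u v j := by
  ext w
  rw [mem_Sbelow_iff _ huv, mem_Sbelow_iff _ huv]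
  refine exists_congr fun k => and_congr_right fun hk => ?_
  rw [walkDiff_congr huv i h k (by omega)]

end WalkDifference

section NoisyGraph

variable {n : ℕ}

lemma noisy_adj_iff (G₀ : SimpleGraph (Fin n)) (h : Sym2 (Fin n) → Bool) (a b : Fin n) :
    (symmDiffG G₀ (graphOfFlip h)).Adj a b ↔
      a ≠ b ∧ ¬ (G₀.Adj a b ↔ h s(a, b) = true) := by
  simp only [symmDiffG, graphOfFlip, SimpleGraph.fromRel_adj, Sym2.eq_swap (a := b) (b := a),
    or_self, G₀.adj_comm b a]
  have hx : ∀ P Q : Prop, Xor' P Q ↔ ¬ (P ↔ Q) := fun P Q => xor_iff_not_iff P Q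
  rw [hx, hx]
  have := @ne_comm _ a b
  tauto

/-- The potential edges meeting `Z`. -/
def edgesTouching (Z : Set (Fin n)) : Set (Sym2 (Fin n)) := {e | ∃ x ∈ Z, x ∈ e}

lemma mk_mem_edgesTouching {Z : Set (Fin n)} {a b : Fin n} :
    s(a, b) ∈ edgesTouching Z ↔ a ∈ Z ∨ b ∈ Z := by
  simp only [edgesTouching, Set.mem_ofPred_eq, Sym2.mem_iff]
  constructor
  · rintro ⟨x, hx, rfl | rfl⟩ <;> simp [hx]
  · rintro (h | h)
    · exact ⟨a, h, Or.inl rfl⟩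
    · exact ⟨b, h, Or.inr rfl⟩

lemma noisy_adj_congr (G₀ : SimpleGraph (Fin n)) {Z : Set (Fin n)} {f g : Sym2 (Fin n) → Bool}
    (h : ∀ e ∈ edgesTouching Z, g e = f e) (x : Fin n) (hx : x ∈ Z) (w : Fin n) :
    (symmDiffG G₀ (graphOfFlip f)).Adj w x ↔ (symmDiffG G₀ (graphOfFlip g)).Adj w x := by
  rw [noisy_adj_iff, noisy_adj_iff, h _ (mk_mem_edgesTouching.2 (Or.inr hx))]

end NoisyGraph

section Growth

lemma bernoulliProb_ne_zero_ge {ι : Type*} [Fintype ι] [DecidableEq ι] {p : ℝ} (h0 : 0 ≤ p)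
    (h1 : p ≤ 1) (Y : Finset ι) (hY : Y.card * p ≤ 1) (Ψ : (ι → Bool) → ℤ)
    (hdep : DependsOnCoords Ψ Y)
    (hflip : ∀ i ∈ Y, ∀ f, Ψ f = 0 → Ψ (Function.update f i (!f i)) ≠ 0) :
    Y.card * p * (1 - Y.card * p) ≤ bernoulliProb p fun f => Ψ f ≠ 0 := by
  have hsp : 0 ≤ Y.card * p := by positivity
  have hpow : ∀ k : ℕ, 1 - k * p ≤ (1 - p) ^ k := by
    intro k
    have := one_add_mul_le_pow (a := -p) (by linarith) k
    have e : 1 + -p = 1 - p := by ring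
    rw [e] at this
    linarith
  by_cases hz : Ψ (fun _ => false) = 0
  · calc Y.card * p * (1 - Y.card * p) ≤ Y.card.choose 1 * p ^ 1 * (1 - p) ^ (Y.card - 1) := by
          rw [Nat.choose_one_right, pow_one]
          refine mul_le_mul_of_nonneg_left (le_trans ?_ (hpow _)) hsp
          have : ((Y.card - 1 : ℕ) : ℝ) ≤ Y.card := by exact_mod_cast Nat.sub_le _ _
          nlinarith
      _ = bernoulliProb p (fun f => (Y.filter fun i => f i = true).card = 1) :=
          (bernoulliProb_card_eq p Y 1).symm
      _ ≤ _ := bernoulliProb_mono h0 h1 fun f hf => by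
          obtain ⟨i, hi⟩ := Finset.card_eq_one.1 hf
          have hi' : ∀ j, (j ∈ Y ∧ f j = true) ↔ j = i := fun j => by
            simpa using congrArg (j ∈ ·) hi
          have := hflip i ((hi' i).2 rfl).1 _ hz
          rw [hdep f _ _]
          · exact this
          · intro j hj
            have hj' : j ∈ Y := hj
            have := hi' j
            by_cases hji : j = i
            · subst hji; simp [(this.2 rfl).2]
            · rw [Function.update_of_ne hji]
              simp only [hj', true_and] at this
              simpa using fun h => hji (this.1 h)
  · calc Y.card * p * (1 - Y.card * p) ≤ 1 - Y.card * p := by nlinarith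
      _ ≤ (1 - p) ^ Y.card := hpow _
      _ = bernoulliProb p (fun f => (Y.filter fun i => f i = true).card = 0) := by
          rw [bernoulliProb_card_eq]; simp
      _ ≤ _ := bernoulliProb_mono h0 h1 fun f hf => by
          rw [Finset.card_eq_zero, Finset.filter_eq_empty_iff] at hf
          rw [hdep f (fun _ => false) _]
          · exact hz
          · intro j hj
            simpa using hf (show j ∈ Y from hj)

variable {n : ℕ}

/-- The noisy graph obtained from `G₀` by toggling the edges selected by `f`. -/
abbrev noisyGraph (G₀ : SimpleGraph (Fin n)) (f : Sym2 (Fin n) → Bool) : SimpleGraph (Fin n) :=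
  symmDiffG G₀ (graphOfFlip f)

open Classical in
/-- The exponential potential used to control the growth of the explored sets. -/
noncomputable def growthPotential (G₀ : SimpleGraph (Fin n)) (u v : Fin n) (N θ κ : ℝ) (i : ℕ)
    (f : Sym2 (Fin n) → Bool) : ℝ :=
  if ((Sbelow (noisyGraph G₀ f) u v i).ncard : ℝ) < N then
    Real.exp (κ * (Sbelow (noisyGraph G₀ f) u v i).ncard -
      θ * (Sat (noisyGraph G₀ f) u v i).ncard) else 0

lemma growthPotential_nonneg (G₀ : SimpleGraph (Fin n)) (u v : Fin n) (N θ κ : ℝ) (i : ℕ)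
    (f : Sym2 (Fin n) → Bool) : 0 ≤ growthPotential G₀ u v N θ κ i f := by
  unfold growthPotential
  split_ifs
  · positivity
  · rfl

lemma Sbelow_noisyGraph_congr (G₀ : SimpleGraph (Fin n)) {u v : Fin n} (huv : u ≠ v) (i : ℕ)
    {f g : Sym2 (Fin n) → Bool}
    (h : ∀ e ∈ edgesTouching (Sbelow (noisyGraph G₀ f) u v i), g e = f e) (j : ℕ)
    (hj : j ≤ i + 1) :
    Sbelow (noisyGraph G₀ g) u v j = Sbelow (noisyGraph G₀ f) u v j :=
  Sbelow_congr huv i (fun x hx w => noisy_adj_congr G₀ h x hx w) j hj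

lemma walkDiff_noisyGraph_congr (G₀ : SimpleGraph (Fin n)) {u v : Fin n} (huv : u ≠ v) (i : ℕ)
    {f g : Sym2 (Fin n) → Bool}
    (h : ∀ e ∈ edgesTouching (Sbelow (noisyGraph G₀ f) u v i), g e = f e) (j : ℕ)
    (hj : j ≤ i) :
    walkDiff (noisyGraph G₀ g) u v j = walkDiff (noisyGraph G₀ f) u v j :=
  walkDiff_congr huv i (fun x hx w => noisy_adj_congr G₀ h x hx w) j hj

lemma growthPotential_splice_le {p : ℝ} (h0 : 0 ≤ p) (h1 : p ≤ 1) (G₀ : SimpleGraph (Fin n))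
    {u v : Fin n} (huv : u ≠ v) {N θ κ : ℝ} (hθ : 0 ≤ θ) (hNn : N ≤ n)
    (hNp : N * p ≤ 1)
    (hpar : θ + κ ≤ (1 - Real.exp (-θ)) * ((n - N) * p * (1 - N * p))) (i : ℕ)
    (f : Sym2 (Fin n) → Bool) :
    (bernoulliExp p fun g => growthPotential G₀ u v N θ κ (i + 1)
      (splice (edgesTouching (Sbelow (noisyGraph G₀ f) u v i)) f g)) ≤
      growthPotential G₀ u v N θ κ i f := by
  classical
  set Z := Sbelow (noisyGraph G₀ f) u v i with hZ
  set B := Sbelow (noisyGraph G₀ f) u v (i + 1) with hB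
  set S := Sat (noisyGraph G₀ f) u v i with hS
  have hcard : B.ncard = Z.ncard + S.ncard := ncard_Sbelow_succ _ u v i
  have hspl : ∀ g, ∀ e ∈ edgesTouching Z, splice (edgesTouching Z) f g e = f e :=
    fun g e he => splice_of_mem he
  have hBg : ∀ g, Sbelow (noisyGraph G₀ (splice (edgesTouching Z) f g)) u v (i + 1) = B :=
    fun g => Sbelow_noisyGraph_congr G₀ huv i (hspl g) (i + 1) le_rfl
  by_cases hBN : (B.ncard : ℝ) < N
  swap
  · refine le_trans (le_of_eq ?_) (growthPotential_nonneg G₀ u v N θ κ i f)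
    have : ∀ g, growthPotential G₀ u v N θ κ (i + 1) (splice (edgesTouching Z) f g) = 0 := by
      intro g
      rw [growthPotential, hBg g, if_neg hBN]
    simp only [this]
    exact bernoulliExp_const p 0
  have hZN : (Z.ncard : ℝ) < N := lt_of_le_of_lt (by exact_mod_cast (by omega)) hBN
  set D := walkDiff (noisyGraph G₀ f) u v i with hD
  have hDg : ∀ g, walkDiff (noisyGraph G₀ (splice (edgesTouching Z) f g)) u v i = D :=
    fun g => walkDiff_noisyGraph_congr G₀ huv i (hspl g) i le_rfl
  let Ψ : Fin n → (Sym2 (Fin n) → Bool) → ℤ := fun w g =>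
    walkDiff (noisyGraph G₀ (splice (edgesTouching Z) f g)) u v (i + 1) w
  have hΨ : ∀ w g, Ψ w g = ∑ x, if (noisyGraph G₀ (splice (edgesTouching Z) f g)).Adj w x
      then D x else 0 := by
    intro w g
    simp only [Ψ, walkDiff, adjOp, hDg g]
  have hBdef : ∀ w, w ∉ B → w ∉ Z ∧ w ∉ S := fun w hw =>
    ⟨fun h => hw (Sbelow_mono _ u v (Nat.le_succ i) h), fun h => hw h.1⟩
  have hSmem : ∀ x, x ∈ S ↔ x ∉ Z ∧ D x ≠ 0 := fun x => mem_Sat_iff _ huv i x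
  have hnotouch : ∀ w, w ∉ B → ∀ x ∈ S, s(w, x) ∉ edgesTouching Z := by
    intro w hw x hx h
    rcases mk_mem_edgesTouching.1 h with h | h
    · exact (hBdef w hw).1 h
    · exact ((hSmem x).1 hx).1 h
  let blk : Fin n → Finset (Sym2 (Fin n)) := fun w => S.toFinset.image fun x => s(w, x)
  have hblkcard : ∀ w, (blk w).card = S.ncard := by
    intro w
    rw [Set.ncard_eq_toFinset_card']
    refine Finset.card_image_of_injective _ fun x y hxy => ?_
    exact Sym2.congr_right.1 hxy
  have hdep : ∀ w, w ∉ B → DependsOnCoords (Ψ w) (blk w) := by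
    intro w hw g g' hgg
    rw [hΨ, hΨ]
    refine Finset.sum_congr rfl fun x _ => ?_
    by_cases hx : D x = 0
    · simp [hx]
    have : splice (edgesTouching Z) f g s(w, x) = splice (edgesTouching Z) f g' s(w, x) := by
      by_cases hxZ : x ∈ Z
      · rw [splice_of_mem (mk_mem_edgesTouching.2 (Or.inr hxZ)),
          splice_of_mem (mk_mem_edgesTouching.2 (Or.inr hxZ))]
      · have hxS := (hSmem x).2 ⟨hxZ, hx⟩
        rw [splice_of_notMem (hnotouch w hw x hxS), splice_of_notMem (hnotouch w hw x hxS)]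
        exact hgg _ (by simp only [blk, Finset.coe_image]; exact ⟨x, by simpa using hxS, rfl⟩)
    simp only [noisy_adj_iff, this]
  have hflip : ∀ w, w ∉ B → ∀ e ∈ blk w, ∀ g, Ψ w g = 0 →
      Ψ w (Function.update g e (!g e)) ≠ 0 := by
    intro w hw e he g hg
    obtain ⟨x, hx, rfl⟩ := Finset.mem_image.1 he
    have hxS : x ∈ S := by simpa using hx
    have hwx : w ≠ x := fun h => (hBdef w hw).2 (h ▸ hxS)
    have hx0 := ((hSmem x).1 hxS).2
    rw [hΨ, ← Finset.add_sum_erase _ _ (Finset.mem_univ x)] at hg ⊢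
    have hrest : ∀ y ∈ Finset.univ.erase x,
        (if (noisyGraph G₀ (splice (edgesTouching Z) f
          (Function.update g s(w, x) (!g s(w, x))))).Adj w y then D y else 0) =
        if (noisyGraph G₀ (splice (edgesTouching Z) f g)).Adj w y then D y else 0 := by
      intro y hy
      have hyx := (Finset.mem_erase.1 hy).1
      have hne : s(w, y) ≠ s(w, x) := by
        exact fun h => hyx (Sym2.congr_right.1 h)
      have : splice (edgesTouching Z) f (Function.update g s(w, x) (!g s(w, x))) s(w, y) =
          splice (edgesTouching Z) f g s(w, y) := by
        simp only [splice, Function.update_of_ne hne]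
      simp only [noisy_adj_iff, this]
    rw [Finset.sum_congr rfl hrest]
    simp only [noisy_adj_iff, splice_of_notMem (hnotouch w hw x hxS), Function.update_self] at hg ⊢
    by_cases hG : G₀.Adj w x <;> cases hgx : g s(w, x) <;> simp [hG, hgx, hwx] at hg ⊢ <;> omega
  have hprob : ∀ w ∈ Finset.univ.filter (· ∉ B),
      S.ncard * p * (1 - S.ncard * p) ≤ bernoulliProb p fun g => Ψ w g ≠ 0 := by
    intro w hw
    have hw' : w ∉ B := (Finset.mem_filter.1 hw).2
    have := bernoulliProb_ne_zero_ge h0 h1 (blk w) ?_ (Ψ w) (hdep w hw') (hflip w hw')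
    · rwa [hblkcard] at this
    · rw [hblkcard]
      have : (S.ncard : ℝ) ≤ B.ncard := by exact_mod_cast (by omega)
      nlinarith
  have hcount := bernoulliExp_exp_neg_count_le h0 h1 θ _ hθ (Finset.univ.filter (· ∉ B))
    (fun w g => Ψ w g ≠ 0) (fun w => (blk w : Set (Sym2 (Fin n)))) ?_ ?_ hprob
  rotate_left
  · intro w hw w' hw' hne
    rw [Finset.disjoint_coe, Finset.disjoint_left]
    intro e he he'
    obtain ⟨x, hx, rfl⟩ := Finset.mem_image.1 he
    obtain ⟨x', hx', h⟩ := Finset.mem_image.1 he'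
    have hxS : x ∈ S := by simpa using hx
    rcases Sym2.eq_iff.1 h with ⟨h1, -⟩ | ⟨h1, -⟩
    · exact hne h1.symm
    · exact (hBdef w' (Finset.mem_filter.1 hw').2).2 (h1 ▸ hxS)
  · intro w hw g g' h
    simp only [hdep w (Finset.mem_filter.1 hw).2 g g' h]
  have hSatg : ∀ g, (Sat (noisyGraph G₀ (splice (edgesTouching Z) f g)) u v (i + 1)).ncard =
      ((Finset.univ.filter (· ∉ B)).filter fun w => Ψ w g ≠ 0).card := by
    intro g
    rw [← Set.ncard_coe_finset]
    congr 1
    ext w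
    rw [mem_Sat_iff _ huv, hBg g]
    simp [Ψ]
  have hval : ∀ g, growthPotential G₀ u v N θ κ (i + 1) (splice (edgesTouching Z) f g) =
      Real.exp (κ * B.ncard) * Real.exp (-θ *
        ((Finset.univ.filter (· ∉ B)).filter fun w => Ψ w g ≠ 0).card) := by
    intro g
    rw [growthPotential, hBg g, if_pos hBN, hSatg g, ← Real.exp_add]
    congr 1
    ring
  simp only [hval]
  rw [bernoulliExp_const_mul, growthPotential, if_pos hZN]
  refine (mul_le_mul_of_nonneg_left hcount (Real.exp_nonneg _)).trans ?_
  rw [← Real.exp_add]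
  refine Real.exp_le_exp.2 ?_
  have hcomp : (((Finset.univ.filter (· ∉ B)).card : ℕ) : ℝ) = n - B.ncard := by
    rw [Set.ncard_eq_toFinset_card', eq_sub_iff_add_eq, ← Nat.cast_add]
    have : Finset.univ.filter (· ∉ B) = B.toFinsetᶜ := by ext; simp
    rw [this, Finset.card_compl_add_card, Fintype.card_fin]
  rw [hcomp]
  have hSB : (S.ncard : ℝ) ≤ N := le_trans (by exact_mod_cast (by omega)) hBN.le
  have hs0 : (0 : ℝ) ≤ S.ncard := Nat.cast_nonneg _
  have hE : 0 ≤ 1 - Real.exp (-θ) := by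
    have : Real.exp (-θ) ≤ 1 := Real.exp_le_one_iff.2 (by linarith)
    linarith
  have hSp : (S.ncard : ℝ) * p ≤ N * p := mul_le_mul_of_nonneg_right hSB h0
  have hA : (n - N) * p * (1 - N * p) * S.ncard ≤
      (n - B.ncard) * (S.ncard * p * (1 - S.ncard * p)) := by
    calc (n - N) * p * (1 - N * p) * S.ncard = (n - N) * (S.ncard * p * (1 - N * p)) := by ring
      _ ≤ (n - N) * (S.ncard * p * (1 - S.ncard * p)) := by
          refine mul_le_mul_of_nonneg_left ?_ (by linarith)
          refine mul_le_mul_of_nonneg_left (by linarith) (by positivity)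
      _ ≤ _ := by
          refine mul_le_mul_of_nonneg_right (by linarith) ?_
          exact mul_nonneg (by positivity) (by linarith)
  have hB' : (B.ncard : ℝ) = Z.ncard + S.ncard := by exact_mod_cast hcard
  have hfin := mul_le_mul_of_nonneg_left hA hE
  have hfin2 := mul_le_mul_of_nonneg_right hpar hs0
  have hk : κ * (B.ncard : ℝ) = κ * Z.ncard + κ * S.ncard := by rw [hB']; ring
  linarith

lemma bernoulliExp_growthPotential_le {p : ℝ} (h0 : 0 ≤ p) (h1 : p ≤ 1)
    (G₀ : SimpleGraph (Fin n)) {u v : Fin n} (huv : u ≠ v) {N θ κ : ℝ} (hθ : 0 ≤ θ)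
    (hNn : N ≤ n) (hNp : N * p ≤ 1)
    (hpar : θ + κ ≤ (1 - Real.exp (-θ)) * ((n - N) * p * (1 - N * p))) (i : ℕ) :
    bernoulliExp p (growthPotential G₀ u v N θ κ i) ≤ 1 := by
  induction i with
  | zero =>
    refine bernoulliExp_le_const h0 h1 fun f => ?_
    unfold growthPotential
    split_ifs
    · rw [Real.exp_le_one_iff]
      have : Sbelow (noisyGraph G₀ f) u v 0 = ∅ := by
        ext w; simp [Sbelow]
      rw [this, Set.ncard_empty]
      have : 0 ≤ θ * (Sat (noisyGraph G₀ f) u v 0).ncard := by positivity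
      simp only [Nat.cast_zero, mul_zero]
      linarith
    · exact zero_le_one
  | succ i ih =>
    refine le_trans ?_ ih
    rw [bernoulliExp_resample p (fun f => edgesTouching (Sbelow (noisyGraph G₀ f) u v i))]
    · exact bernoulliExp_mono h0 h1 fun f =>
        growthPotential_splice_le h0 h1 G₀ huv hθ hNn hNp hpar i f
    · intro f g h
      simp only [Sbelow_noisyGraph_congr G₀ huv i h i (Nat.le_succ i)]

/-- It is unlikely that a small explored set has an exceptionally small boundary layer. -/
lemma bernoulliProb_slow_growth_le {p : ℝ} (h0 : 0 ≤ p) (h1 : p ≤ 1)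
    (G₀ : SimpleGraph (Fin n)) {u v : Fin n} (huv : u ≠ v) {N θ κ : ℝ} (hθ : 0 ≤ θ)
    (hNn : N ≤ n) (hNp : N * p ≤ 1)
    (hpar : θ + κ ≤ (1 - Real.exp (-θ)) * ((n - N) * p * (1 - N * p))) (t : ℝ) (i : ℕ) :
    bernoulliProb p (fun f => ((Sbelow (noisyGraph G₀ f) u v i).ncard : ℝ) < N ∧
      t ≤ κ * (Sbelow (noisyGraph G₀ f) u v i).ncard -
        θ * (Sat (noisyGraph G₀ f) u v i).ncard) ≤ Real.exp (-t) := by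
  refine (bernoulliProb_le_of_exp h0 h1 (Real.exp (-t))
    (growthPotential_nonneg G₀ u v N θ κ i) ?_ (Real.exp_nonneg _)).trans ?_
  · rintro f ⟨hf, hf'⟩
    rw [growthPotential, if_pos hf, ← Real.exp_add]
    exact Real.one_le_exp (by linarith)
  · exact mul_le_of_le_one_right (Real.exp_nonneg _)
      (bernoulliExp_growthPotential_le h0 h1 G₀ huv hθ hNn hNp hpar i)

end Growth

section LittlewoodOfford

lemma centralBinom_sq_mul_le (k : ℕ) : (2 * k + 1) * k.centralBinom ^ 2 ≤ 16 ^ k := by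
  induction k with
  | zero => simp
  | succ k ih =>
    have h := Nat.succ_mul_centralBinom_succ k
    have h2 : (k + 1) ^ 2 * ((2 * (k + 1) + 1) * (k + 1).centralBinom ^ 2) ≤
        (k + 1) ^ 2 * 16 ^ (k + 1) := by
      calc (k + 1) ^ 2 * ((2 * (k + 1) + 1) * (k + 1).centralBinom ^ 2)
          = (2 * k + 3) * ((k + 1) * (k + 1).centralBinom) ^ 2 := by ring
        _ = (4 * (2 * k + 1) * (2 * k + 3)) * ((2 * k + 1) * k.centralBinom ^ 2) := by
            rw [h]; ring
        _ ≤ (16 * (k + 1) ^ 2) * 16 ^ k := Nat.mul_le_mul (by nlinarith) ih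
        _ = (k + 1) ^ 2 * 16 ^ (k + 1) := by ring
    exact Nat.le_of_mul_le_mul_left h2 (by positivity)

lemma succ_mul_choose_half_sq_le (N : ℕ) : (N + 1) * N.choose (N / 2) ^ 2 ≤ 4 ^ N := by
  obtain ⟨k, rfl | rfl⟩ := Nat.even_or_odd' N
  · rw [Nat.mul_div_cancel_left k two_pos, pow_mul]
    exact centralBinom_sq_mul_le k
  · have e : (2 * k + 1) / 2 = k := by omega
    rw [e]
    have h1 : (k + 1).centralBinom = 2 * (2 * k + 1).choose k := by
      rw [Nat.centralBinom_eq_two_mul_choose, show 2 * (k + 1) = (2 * k + 1) + 1 by ring,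
        Nat.choose_succ_succ, Nat.choose_symm_half]
      exact (two_mul _).symm
    have h2 := centralBinom_sq_mul_le (k + 1)
    rw [h1] at h2
    have h3 : (16 : ℕ) ^ (k + 1) = 4 * 4 ^ (2 * k + 1) := by
      rw [show (16 : ℕ) = 4 ^ 2 by norm_num, ← pow_mul, ← pow_succ']
      congr 1
    rw [h3] at h2
    generalize (2 * k + 1).choose k = C at h2 ⊢
    nlinarith [Nat.zero_le (C ^ 2)]

/-- The Littlewood–Offord bound, in Erdős's form. -/
lemma card_subset_sum_eq_le {κ : Type*} [DecidableEq κ] (s : Finset κ) (a : κ → ℤ)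
    (ha : ∀ k ∈ s, a k ≠ 0) (c : ℤ) :
    (s.powerset.filter fun Q => ∑ k ∈ Q, a k = c).card ≤ s.card.choose (s.card / 2) := by
  classical
  let c' : ℤ := c + ∑ k : s, if a k < 0 then |a k| else 0
  let B : Finset (Finset s) := Finset.univ.filter fun R => ∑ k ∈ R, |a k| = c'
  have hB : IsAntichain (· ⊆ ·) (B : Set (Finset s)) := by
    intro R hR R' hR' hne hsub
    have h1 : ∑ k ∈ R, |a k| = c' := by simpa [B] using hR
    have h2 : ∑ k ∈ R', |a k| = c' := by simpa [B] using hR'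
    obtain ⟨k, hk, hk'⟩ := Finset.exists_of_ssubset (hsub.ssubset_of_ne hne)
    have := Finset.sum_lt_sum_of_subset hsub hk hk' (f := fun k : s => |a k|)
      (abs_pos.2 (ha k k.2)) (fun j _ _ => abs_nonneg _)
    omega
  have hS := hB.sperner
  rw [Fintype.card_coe] at hS
  refine le_trans (Finset.card_le_card_of_injOn
    (fun Q => Finset.univ.filter fun k : s => ¬ ((k : κ) ∈ Q ↔ a k < 0)) ?_ ?_) hS
  · intro Q hQ
    simp only [Finset.coe_filter, Set.mem_ofPred_eq, Finset.mem_powerset] at hQ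
    simp only [B, Finset.coe_filter, Set.mem_ofPred_eq, Finset.mem_univ, true_and, c']
    have hsum : ∑ k ∈ Q, a k = ∑ k : s, if (k : κ) ∈ Q then a k else 0 := by
      rw [Finset.sum_coe_sort s (fun k => if k ∈ Q then a k else 0), ← Finset.sum_filter,
        Finset.filter_mem_eq_inter, Finset.inter_eq_right.2 hQ.1]
    rw [← hQ.2, hsum, Finset.sum_filter, ← Finset.sum_add_distrib]
    refine Finset.sum_congr rfl fun k _ => ?_
    by_cases h1 : (k : κ) ∈ Q <;> by_cases h2 : a k < 0
    · simp [h1, h2, abs_of_neg h2]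
    · simp [h1, h2, abs_of_nonneg (not_lt.1 h2)]
    · simp [h1, h2, abs_of_neg h2]
    · simp [h1, h2]
  · intro Q hQ Q' hQ' h
    simp only [Finset.coe_filter, Set.mem_ofPred_eq, Finset.mem_powerset] at hQ hQ'
    ext k
    by_cases hk : k ∈ s
    · have := congrArg (fun R : Finset s => (⟨k, hk⟩ : s) ∈ R) h
      simp only [Finset.mem_filter, Finset.mem_univ, true_and, eq_iff_iff] at this
      tauto
    · exact ⟨fun h => absurd (hQ.1 h) hk, fun h => absurd (hQ'.1 h) hk⟩

lemma bernoulliProb_half_sum_eq_le {κ : Type*} [Fintype κ] [DecidableEq κ] (s : Finset κ)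
    (a : κ → ℤ) (ha : ∀ k ∈ s, a k ≠ 0) (c : ℤ) :
    bernoulliProb (1 / 2) (fun τ : κ → Bool => ∑ k ∈ s, (if τ k then a k else 0) = c) ≤
      1 / √(s.card + 1) := by
  classical
  have h1 : bernoulliProb (1 / 2) (fun τ : κ → Bool => ∑ k ∈ s, (if τ k then a k else 0) = c) ≤
      ∑ Q ∈ s.powerset.filter (fun Q => ∑ k ∈ Q, a k = c),
        bernoulliProb (1 / 2) fun τ : κ → Bool => ∀ k ∈ s, (τ k = true ↔ k ∈ Q) := by
    refine le_trans (bernoulliProb_mono (by norm_num) (by norm_num) fun τ hτ => ?_)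
      (bernoulliProb_exists_le (by norm_num) (by norm_num) _ _)
    refine ⟨s.filter fun k => τ k = true, ?_, ?_⟩
    · simp only [Finset.mem_filter, Finset.mem_powerset]
      exact ⟨Finset.filter_subset _ _, by rw [Finset.sum_filter]; exact hτ⟩
    · intro k hk; simp [hk]
  have h2 : ∀ Q ∈ s.powerset.filter (fun Q => ∑ k ∈ Q, a k = c),
      (bernoulliProb (1 / 2) fun τ : κ → Bool => ∀ k ∈ s, (τ k = true ↔ k ∈ Q)) =
        (1 / 2) ^ s.card := by
    intro Q hQ
    have hQs : Q ⊆ s := Finset.mem_powerset.1 (Finset.mem_filter.1 hQ).1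
    rw [bernoulliProb_pattern _ _ _ hQs, show (1 : ℝ) - 1 / 2 = 1 / 2 by norm_num, ← pow_add,
      Nat.add_sub_cancel' (Finset.card_le_card hQs)]
  rw [Finset.sum_congr rfl h2, Finset.sum_const, nsmul_eq_mul] at h1
  refine h1.trans ?_
  have h3 : ((s.powerset.filter fun Q => ∑ k ∈ Q, a k = c).card : ℝ) ≤
      (s.card.choose (s.card / 2) : ℝ) := by exact_mod_cast card_subset_sum_eq_le s a ha c
  refine (mul_le_mul_of_nonneg_right h3 (by positivity)).trans ?_
  have h4 : ((s.card : ℝ) + 1) * (s.card.choose (s.card / 2) : ℝ) ^ 2 ≤ 4 ^ s.card := by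
    exact_mod_cast succ_mul_choose_half_sq_le s.card
  rw [le_div_iff₀ (by positivity)]
  refine abs_le_of_sq_le_sq' (a := _) ?_ zero_le_one |>.2
  rw [mul_pow, mul_pow, Real.sq_sqrt (by positivity), ← pow_mul, mul_comm s.card 2, pow_mul]
  calc _ = (((s.card : ℝ) + 1) * (s.card.choose (s.card / 2) : ℝ) ^ 2) *
        ((1 / 2) ^ 2) ^ s.card := by ring
    _ ≤ 4 ^ s.card * ((1 / 2) ^ 2) ^ s.card := by gcongr
    _ = 1 ^ 2 := by rw [← mul_pow]; norm_num

end LittlewoodOfford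

section Gadgets

variable {n : ℕ}

/-- A system of `m` gadgets. Each gadget consists of two poles, together with two disjoint sets of
`M` vertices each, on which the adjacencies in `G₀` to the two poles are constant and equal. -/
structure GadgetSystem (G₀ : SimpleGraph (Fin n)) (m M : ℕ) where
  pole : Fin m → Bool → Fin n
  slot : Fin m → Finset (Fin n)
  rest : Fin m → Finset (Fin n)
  sgn : Fin m → Bool
  pole_inj : ∀ k t k' t', pole k t = pole k' t' → k = k' ∧ t = t'
  card_slot : ∀ k, (slot k).card = M
  card_rest : ∀ k, (rest k).card = M
  disjoint : ∀ k, Disjoint (slot k) (rest k)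
  pole_notMem : ∀ k t k', pole k t ∉ slot k' ∪ rest k'
  adj_iff : ∀ k t, ∀ c ∈ slot k ∪ rest k, G₀.Adj (pole k t) c ↔ sgn k = true

/-- The potential edges between the poles of a gadget and its two sets. -/
def GadgetSystem.hidden {G₀ : SimpleGraph (Fin n)} {m M : ℕ} (Γ : GadgetSystem G₀ m M) :
    Set (Sym2 (Fin n)) :=
  {e | ∃ k t, ∃ c ∈ Γ.slot k ∪ Γ.rest k, e = s(Γ.pole k t, c)}

lemma exists_gadgetSystem (G₀ : SimpleGraph (Fin n)) (m M : ℕ) (Z X : Finset (Fin n))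
    (hX : 3 * m ≤ X.card) (hZ : Z.card + 3 * m + 12 * M ≤ n) :
    ∃ Γ : GadgetSystem G₀ m M, (∀ k t, Γ.pole k t ∈ X) ∧
      ∀ k, Disjoint (Γ.slot k ∪ Γ.rest k) Z := by
  classical
  obtain ⟨e⟩ : Nonempty (Fin m × Fin 3 ↪ X) :=
    Function.Embedding.nonempty_of_card_le (by simp; omega)
  let q : Fin m → Fin 3 → Fin n := fun k l => e (k, l)
  have hq : ∀ k l k' l', q k l = q k' l' → k = k' ∧ l = l' := by
    intro k l k' l' h
    exact Prod.mk_inj.1 (e.injective (Subtype.ext h))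
  let P : Finset (Fin n) := Finset.univ.image fun kl : Fin m × Fin 3 => q kl.1 kl.2
  have hP : P.card ≤ 3 * m := by
    refine Finset.card_image_le.trans ?_
    simp; omega
  let C : Finset (Fin n) := (Z ∪ P)ᶜ
  have hC : 6 * (2 * M) ≤ C.card := by
    have h1 := Finset.card_compl_add_card (Z ∪ P)
    have h2 := Finset.card_union_le Z P
    rw [Fintype.card_fin] at h1
    simp only [C]
    omega
  have key : ∀ k : Fin m, ∃ y : Fin 3 × Bool, ∃ S R : Finset (Fin n), S ⊆ C ∧ R ⊆ C ∧
      S.card = M ∧ R.card = M ∧ Disjoint S R ∧ ∀ c ∈ S ∪ R,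
        (G₀.Adj (q k y.1) c ↔ y.2 = true) ∧ (G₀.Adj (q k (y.1 + 1)) c ↔ y.2 = true) := by
    intro k
    have h3 : ∀ c, ∃ y : Fin 3 × Bool,
        (G₀.Adj (q k y.1) c ↔ y.2 = true) ∧ (G₀.Adj (q k (y.1 + 1)) c ↔ y.2 = true) := by
      intro c
      by_cases h0 : G₀.Adj (q k 0) c <;> by_cases h1 : G₀.Adj (q k 1) c <;>
        by_cases h2 : G₀.Adj (q k 2) c
      · exact ⟨(0, true), by simp [h0, h1]⟩
      · exact ⟨(0, true), by simp [h0, h1]⟩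
      · exact ⟨(2, true), by simp [h0, h2, show (2 + 1 : Fin 3) = 0 from rfl]⟩
      · exact ⟨(1, false), by simp [h1, h2, show (1 + 1 : Fin 3) = 2 from rfl]⟩
      · exact ⟨(1, true), by simp [h1, h2, show (1 + 1 : Fin 3) = 2 from rfl]⟩
      · exact ⟨(2, false), by simp [h0, h2, show (2 + 1 : Fin 3) = 0 from rfl]⟩
      · exact ⟨(0, false), by simp [h0, h1]⟩
      · exact ⟨(0, false), by simp [h0, h1]⟩
    choose F hF using h3
    obtain ⟨y, -, hy⟩ := Finset.exists_le_card_fiber_of_mul_le_card_of_maps_to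
      (s := C) (t := Finset.univ) (f := F) (n := 2 * M) (fun _ _ => Finset.mem_univ _)
      Finset.univ_nonempty (by simpa using hC)
    obtain ⟨S, hS, hSM⟩ := Finset.exists_subset_card_eq (n := M)
      (s := C.filter (F · = y)) (by omega)
    obtain ⟨R, hR, hRM⟩ := Finset.exists_subset_card_eq (n := M)
      (s := C.filter (F · = y) \ S) (by
        rw [Finset.card_sdiff_of_subset hS, hSM]; omega)
    have hR' : R ⊆ C.filter (F · = y) := hR.trans Finset.sdiff_subset
    refine ⟨y, S, R, hS.trans (Finset.filter_subset _ _), hR'.trans (Finset.filter_subset _ _),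
      hSM, hRM, Finset.disjoint_of_subset_right hR Finset.disjoint_sdiff, fun c hc => ?_⟩
    have hcF : F c = y := by
      rcases Finset.mem_union.1 hc with h | h
      · exact (Finset.mem_filter.1 (hS h)).2
      · exact (Finset.mem_filter.1 (hR' h)).2
    exact hcF ▸ hF c
  choose y S R hS hR hSM hRM hSR hadj using key
  have hSRC : ∀ k, S k ∪ R k ⊆ C := fun k => Finset.union_subset (hS k) (hR k)
  refine ⟨{
    pole := fun k t => q k (if t then (y k).1 + 1 else (y k).1)
    slot := S
    rest := R
    sgn := fun k => (y k).2
    pole_inj := ?_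
    card_slot := hSM
    card_rest := hRM
    disjoint := hSR
    pole_notMem := ?_
    adj_iff := ?_ }, ?_, ?_⟩
  · intro k t k' t' h
    obtain ⟨rfl, h'⟩ := hq _ _ _ _ h
    refine ⟨rfl, ?_⟩
    cases t <;> cases t' <;> simp at h' ⊢
  · intro k t k' h
    have h1 := hSRC k' h
    simp only [C, Finset.mem_compl, Finset.mem_union, not_or] at h1
    exact h1.2 (Finset.mem_image.2 ⟨(k, _), Finset.mem_univ _, rfl⟩)
  · intro k t c hc
    cases t
    · simpa using (hadj k c hc).1
    · simpa using (hadj k c hc).2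
  · intro k t
    exact (e _).2
  · intro k
    rw [Finset.disjoint_left]
    intro c hc hcZ
    have h1 := hSRC k hc
    simp only [C, Finset.mem_compl, Finset.mem_union, not_or] at h1
    exact h1.1 hcZ

end Gadgets

section GadgetSwap

variable {n : ℕ} {G₀ : SimpleGraph (Fin n)} {m M : ℕ}

namespace GadgetSystem

open Classical in
/-- The involution exchanging the two poles of every gadget. -/
noncomputable def flip (Γ : GadgetSystem G₀ m M) (v : Fin n) : Fin n :=
  if h : ∃ q : Fin m × Bool, Γ.pole q.1 q.2 = v then Γ.pole h.choose.1 (!h.choose.2) else v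

lemma flip_pole (Γ : GadgetSystem G₀ m M) (k : Fin m) (t : Bool) :
    Γ.flip (Γ.pole k t) = Γ.pole k (!t) := by
  have h : ∃ q : Fin m × Bool, Γ.pole q.1 q.2 = Γ.pole k t := ⟨(k, t), rfl⟩
  obtain ⟨h1, h2⟩ := Γ.pole_inj _ _ _ _ h.choose_spec
  rw [flip, dif_pos h, h1, h2]

/-- The selected gadget edges: `v` is a pole of a gadget selected by `τ` and `c` is in its slot. -/
def Selected (Γ : GadgetSystem G₀ m M) (τ : Fin m → Bool) (v c : Fin n) : Prop :=
  ∃ k t, v = Γ.pole k t ∧ τ k = true ∧ c ∈ Γ.slot k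

lemma selected_pole (Γ : GadgetSystem G₀ m M) (τ : Fin m → Bool) (k : Fin m) (t : Bool)
    (c : Fin n) : Γ.Selected τ (Γ.pole k t) c ↔ τ k = true ∧ c ∈ Γ.slot k := by
  constructor
  · rintro ⟨k', t', h, h'⟩
    obtain ⟨rfl, -⟩ := Γ.pole_inj _ _ _ _ h
    exact h'
  · exact fun h => ⟨k, t, rfl, h⟩

lemma Selected.flip {Γ : GadgetSystem G₀ m M} {τ : Fin m → Bool} {v c : Fin n}
    (h : Γ.Selected τ v c) : Γ.Selected τ (Γ.flip v) c := by
  obtain ⟨k, t, rfl, h⟩ := h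
  rw [flip_pole, selected_pole]
  exact h

lemma Selected.flip_flip {Γ : GadgetSystem G₀ m M} {τ : Fin m → Bool} {v c : Fin n}
    (h : Γ.Selected τ v c) : Γ.flip (Γ.flip v) = v := by
  obtain ⟨k, t, rfl, h⟩ := h
  rw [flip_pole, flip_pole, Bool.not_not]

lemma not_selected_of_mem {Γ : GadgetSystem G₀ m M} {τ : Fin m → Bool} {k : Fin m} {v c : Fin n}
    (h : c ∈ Γ.slot k) : ¬ Γ.Selected τ c v := by
  rintro ⟨k', t, rfl, -⟩
  exact Γ.pole_notMem k' t k (Finset.mem_union_left _ h)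

lemma Selected.not_swap {Γ : GadgetSystem G₀ m M} {τ : Fin m → Bool} {v c : Fin n}
    (h : Γ.Selected τ v c) (d : Fin n) : ¬ Γ.Selected τ c d := by
  obtain ⟨k, t, -, -, h⟩ := h
  exact not_selected_of_mem h

open Classical in
/-- The endpoint `v` of the edge `s(v, c)` after exchanging poles in the selected gadgets. -/
noncomputable def swapEnd (Γ : GadgetSystem G₀ m M) (τ : Fin m → Bool) (c v : Fin n) : Fin n :=
  if Γ.Selected τ v c then Γ.flip v else v

lemma swapEnd_of_not {Γ : GadgetSystem G₀ m M} {τ : Fin m → Bool} {v c : Fin n}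
    (h : ¬ Γ.Selected τ v c) : Γ.swapEnd τ c v = v := by
  simp [swapEnd, h]

lemma swapEnd_of_selected {Γ : GadgetSystem G₀ m M} {τ : Fin m → Bool} {v c : Fin n}
    (h : Γ.Selected τ v c) : Γ.swapEnd τ c v = Γ.flip v := by
  simp [swapEnd, h]

/-- The map on potential edges exchanging the slot edges at the two poles of selected gadgets. -/
noncomputable def swapEdge (Γ : GadgetSystem G₀ m M) (τ : Fin m → Bool) :
    Sym2 (Fin n) → Sym2 (Fin n) :=
  Sym2.lift ⟨fun v c => s(Γ.swapEnd τ c v, Γ.swapEnd τ v c), fun _ _ => Sym2.eq_swap⟩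

lemma swapEdge_mk (Γ : GadgetSystem G₀ m M) (τ : Fin m → Bool) (v c : Fin n) :
    Γ.swapEdge τ s(v, c) = s(Γ.swapEnd τ c v, Γ.swapEnd τ v c) := rfl

lemma swapEdge_of_selected {Γ : GadgetSystem G₀ m M} {τ : Fin m → Bool} {v c : Fin n}
    (h : Γ.Selected τ v c) : Γ.swapEdge τ s(v, c) = s(Γ.flip v, c) := by
  rw [swapEdge_mk, swapEnd_of_selected h, swapEnd_of_not (h.not_swap v)]

lemma swapEdge_of_not {Γ : GadgetSystem G₀ m M} {τ : Fin m → Bool} {v c : Fin n}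
    (h : ¬ Γ.Selected τ v c) (h' : ¬ Γ.Selected τ c v) : Γ.swapEdge τ s(v, c) = s(v, c) := by
  rw [swapEdge_mk, swapEnd_of_not h, swapEnd_of_not h']

lemma swapEdge_involutive (Γ : GadgetSystem G₀ m M) (τ : Fin m → Bool) :
    Function.Involutive (Γ.swapEdge τ) := by
  have key : ∀ v c, Γ.Selected τ v c → Γ.swapEdge τ (Γ.swapEdge τ s(v, c)) = s(v, c) := by
    intro v c h
    rw [swapEdge_of_selected h, swapEdge_of_selected h.flip, h.flip_flip]
  intro e
  induction e using Sym2.ind with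
  | _ v c =>
    by_cases h : Γ.Selected τ v c
    · exact key v c h
    · by_cases h' : Γ.Selected τ c v
      · rw [Sym2.eq_swap]; exact key c v h'
      · rw [swapEdge_of_not h h', swapEdge_of_not h h']

lemma mem_hidden_of_selected {Γ : GadgetSystem G₀ m M} {τ : Fin m → Bool} {v c : Fin n}
    (h : Γ.Selected τ v c) : s(v, c) ∈ Γ.hidden := by
  obtain ⟨k, t, rfl, -, h⟩ := h
  exact ⟨k, t, c, Finset.mem_union_left _ h, rfl⟩

lemma swapEdge_of_notMem_hidden {Γ : GadgetSystem G₀ m M} (τ : Fin m → Bool) {e : Sym2 (Fin n)}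
    (he : e ∉ Γ.hidden) : Γ.swapEdge τ e = e := by
  induction e using Sym2.ind with
  | _ v c =>
    refine swapEdge_of_not (fun h => he (mem_hidden_of_selected h)) fun h => he ?_
    rw [Sym2.eq_swap]
    exact mem_hidden_of_selected h

/-- `swapEdge` as a permutation of the potential edges. -/
noncomputable def swapPerm (Γ : GadgetSystem G₀ m M) (τ : Fin m → Bool) :
    Equiv.Perm (Sym2 (Fin n)) := (Γ.swapEdge_involutive τ).toPerm

lemma splice_comp_swapPerm (Γ : GadgetSystem G₀ m M) (τ : Fin m → Bool)
    (f g : Sym2 (Fin n) → Bool) :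
    splice Γ.hiddenᶜ f (g ∘ Γ.swapPerm τ) = splice Γ.hiddenᶜ f g ∘ Γ.swapPerm τ := by
  have hmem : ∀ e, e ∈ Γ.hidden → Γ.swapEdge τ e ∈ Γ.hidden := by
    intro e he
    by_contra h
    have := swapEdge_of_notMem_hidden τ h
    rw [Γ.swapEdge_involutive τ e] at this
    exact h (this ▸ he)
  funext e
  by_cases he : e ∈ Γ.hidden
  · rw [splice_of_notMem (by simpa using he), Function.comp_apply, Function.comp_apply,
      splice_of_notMem]
    exact fun h => h (hmem e he)
  · rw [splice_of_mem (by simpa using he), Function.comp_apply]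
    have : Γ.swapPerm τ e = e := swapEdge_of_notMem_hidden τ he
    rw [this, splice_of_mem (by simpa using he)]

/-- The degree of a vertex that is not a pole is unaffected by the swaps. -/
lemma neighborCount_swap_of_not_pole (Γ : GadgetSystem G₀ m M) (τ : Fin m → Bool)
    (h : Sym2 (Fin n) → Bool) (w : Fin n) (hw : ∀ k t, w ≠ Γ.pole k t) :
    neighborCount (noisyGraph G₀ (h ∘ Γ.swapPerm τ)) w = neighborCount (noisyGraph G₀ h) w := by
  classical
  have hR : ∀ c, ¬ Γ.Selected τ w c := fun c ⟨k, t, h, _⟩ => hw k t h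
  have hinv : ∀ c, Γ.swapEnd τ w (Γ.swapEnd τ w c) = c := by
    intro c
    by_cases hc : Γ.Selected τ c w
    · rw [swapEnd_of_selected hc, swapEnd_of_selected hc.flip, hc.flip_flip]
    · rw [swapEnd_of_not hc, swapEnd_of_not hc]
  have hadj : ∀ c, (noisyGraph G₀ (h ∘ Γ.swapPerm τ)).Adj w c ↔
      (noisyGraph G₀ h).Adj w (Γ.swapEnd τ w c) := by
    intro c
    have e : (h ∘ Γ.swapPerm τ) s(w, c) = h s(w, Γ.swapEnd τ w c) := by
      change h (Γ.swapEdge τ s(w, c)) = _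
      rw [swapEdge_mk, swapEnd_of_not (hR c)]
    rw [noisy_adj_iff, noisy_adj_iff, e]
    by_cases hc : Γ.Selected τ c w
    · rw [swapEnd_of_selected hc]
      obtain ⟨k, t, rfl, -, hs⟩ := hc
      have h1 := Γ.adj_iff k t w (Finset.mem_union_left _ hs)
      have h2 := Γ.adj_iff k (!t) w (Finset.mem_union_left _ hs)
      rw [flip_pole, G₀.adj_comm, h1, G₀.adj_comm, h2]
      simp [hw k t, hw k (!t)]
    · rw [swapEnd_of_not hc]
  unfold neighborCount
  refine Finset.card_bij (fun c _ => Γ.swapEnd τ w c) ?_ ?_ ?_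
  · intro c hc
    simpa [hadj] using hc
  · intro c _ c' _ hcc
    have := congrArg (Γ.swapEnd τ w) hcc
    rwa [hinv, hinv] at this
  · intro c hc
    refine ⟨Γ.swapEnd τ w c, ?_, hinv c⟩
    simpa [hadj, hinv] using hc

open Classical in
/-- The number of selected potential edges between the pole `t` of the gadget `k` and `A`. -/
noncomputable def hits (Γ : GadgetSystem G₀ m M) (h : Sym2 (Fin n) → Bool) (k : Fin m) (t : Bool)
    (A : Finset (Fin n)) : ℕ :=
  (A.filter fun c => h s(Γ.pole k t, c) = true).card

open Classical in
/-- The contribution to the degree of a pole which does not depend on the hidden edges. -/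
noncomputable def baseDegree (Γ : GadgetSystem G₀ m M) (h : Sym2 (Fin n) → Bool) (k : Fin m)
    (t : Bool) : ℤ :=
  (((Γ.slot k ∪ Γ.rest k)ᶜ.filter fun c => (noisyGraph G₀ h).Adj (Γ.pole k t) c).card : ℤ) +
    if Γ.sgn k then 2 * M else 0

/-- The sign with which the hidden edges contribute to the degrees of the poles. -/
def sign (Γ : GadgetSystem G₀ m M) (k : Fin m) : ℤ := if Γ.sgn k then -1 else 1

lemma neighborCount_pole (Γ : GadgetSystem G₀ m M) (h : Sym2 (Fin n) → Bool) (k : Fin m)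
    (t : Bool) : (neighborCount (noisyGraph G₀ h) (Γ.pole k t) : ℤ) =
      Γ.baseDegree h k t + Γ.sign k * (Γ.hits h k t (Γ.slot k) + Γ.hits h k t (Γ.rest k)) := by
  classical
  have hU : (Γ.slot k ∪ Γ.rest k).card = 2 * M := by
    rw [Finset.card_union_of_disjoint (Γ.disjoint k), Γ.card_slot, Γ.card_rest, two_mul]
  have hhits : Γ.hits h k t (Γ.slot k) + Γ.hits h k t (Γ.rest k) =
      ((Γ.slot k ∪ Γ.rest k).filter fun c => h s(Γ.pole k t, c) = true).card := by
    rw [Finset.filter_union, Finset.card_union_of_disjoint]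
    · rfl
    · exact Finset.disjoint_filter_filter (Γ.disjoint k)
  have hsplit : neighborCount (noisyGraph G₀ h) (Γ.pole k t) =
      ((Γ.slot k ∪ Γ.rest k).filter fun c => (noisyGraph G₀ h).Adj (Γ.pole k t) c).card +
      ((Γ.slot k ∪ Γ.rest k)ᶜ.filter fun c => (noisyGraph G₀ h).Adj (Γ.pole k t) c).card := by
    unfold neighborCount
    rw [← Finset.card_union_of_disjoint, ← Finset.filter_union, Finset.union_compl]
    exact Finset.disjoint_filter_filter disjoint_compl_right
  have hin : ∀ c ∈ Γ.slot k ∪ Γ.rest k, ((noisyGraph G₀ h).Adj (Γ.pole k t) c ↔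
      ¬ (Γ.sgn k = true ↔ h s(Γ.pole k t, c) = true)) := by
    intro c hc
    rw [noisy_adj_iff, Γ.adj_iff k t c hc]
    exact and_iff_right fun heq => Γ.pole_notMem k t k (heq ▸ hc)
  rw [hsplit, Finset.filter_congr hin, baseDegree, sign]
  have hc2 := Finset.card_filter_add_card_filter_not (s := Γ.slot k ∪ Γ.rest k)
    (fun c => h s(Γ.pole k t, c) = true)
  rw [hU, ← hhits] at hc2
  by_cases hs : Γ.sgn k = true
  · simp only [hs, true_iff, if_true]
    push_cast
    push_cast [← @Nat.cast_inj ℤ] at hc2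
    linarith
  · rw [Bool.not_eq_true] at hs
    simp only [hs, Bool.false_eq_true, false_iff, not_not, if_false]
    push_cast [← @Nat.cast_inj ℤ] at hhits
    push_cast
    linarith

lemma hits_swap_slot (Γ : GadgetSystem G₀ m M) (τ : Fin m → Bool) (h : Sym2 (Fin n) → Bool)
    (k : Fin m) (t : Bool) :
    Γ.hits (h ∘ Γ.swapPerm τ) k t (Γ.slot k) = Γ.hits h k (t ^^ τ k) (Γ.slot k) := by
  classical
  unfold hits
  congr 1
  refine Finset.filter_congr fun c hc => ?_
  change h (Γ.swapEdge τ s(Γ.pole k t, c)) = true ↔ _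
  by_cases hτ : τ k = true
  · rw [swapEdge_of_selected ((selected_pole Γ τ k t c).2 ⟨hτ, hc⟩), flip_pole, hτ]
    simp
  · rw [swapEdge_of_not (fun h => hτ ((selected_pole Γ τ k t c).1 h).1) (not_selected_of_mem hc)]
    simp [hτ]

lemma swapEdge_pole_of_notMem (Γ : GadgetSystem G₀ m M) (τ : Fin m → Bool) (k : Fin m) (t : Bool)
    {c : Fin n} (hc : ¬ Γ.Selected τ c (Γ.pole k t)) (hc' : c ∉ Γ.slot k) :
    Γ.swapEdge τ s(Γ.pole k t, c) = s(Γ.pole k t, c) :=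
  swapEdge_of_not (fun h => hc' ((selected_pole Γ τ k t c).1 h).2) hc

lemma not_selected_pole (Γ : GadgetSystem G₀ m M) (τ : Fin m → Bool) (k : Fin m) (t : Bool)
    (c : Fin n) : ¬ Γ.Selected τ c (Γ.pole k t) := by
  rintro ⟨k', t', -, -, h⟩
  exact Γ.pole_notMem k t k' (Finset.mem_union_left _ h)

lemma hits_swap_rest (Γ : GadgetSystem G₀ m M) (τ : Fin m → Bool) (h : Sym2 (Fin n) → Bool)
    (k : Fin m) (t : Bool) :
    Γ.hits (h ∘ Γ.swapPerm τ) k t (Γ.rest k) = Γ.hits h k t (Γ.rest k) := by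
  classical
  unfold hits
  congr 1
  refine Finset.filter_congr fun c hc => ?_
  change h (Γ.swapEdge τ s(Γ.pole k t, c)) = true ↔ _
  rw [swapEdge_pole_of_notMem Γ τ k t (not_selected_pole Γ τ k t c)
    (Finset.disjoint_right.1 (Γ.disjoint k) hc)]

lemma notMem_hidden_of_notMem (Γ : GadgetSystem G₀ m M) (k : Fin m) (t : Bool) {c : Fin n}
    (hc : c ∉ Γ.slot k ∪ Γ.rest k) : s(Γ.pole k t, c) ∉ Γ.hidden := by
  rintro ⟨k', t', c', hc', h⟩
  rcases Sym2.eq_iff.1 h with ⟨h1, rfl⟩ | ⟨h1, -⟩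
  · obtain ⟨rfl, -⟩ := Γ.pole_inj _ _ _ _ h1
    exact hc hc'
  · exact Γ.pole_notMem k t k' (h1 ▸ hc')

lemma baseDegree_congr (Γ : GadgetSystem G₀ m M) {f h : Sym2 (Fin n) → Bool}
    (hfh : ∀ e ∉ Γ.hidden, h e = f e) (k : Fin m) (t : Bool) :
    Γ.baseDegree h k t = Γ.baseDegree f k t := by
  classical
  unfold baseDegree
  congr 3
  refine Finset.filter_congr fun c hc => ?_
  rw [noisy_adj_iff, noisy_adj_iff, hfh _ (notMem_hidden_of_notMem Γ k t (by simpa using hc))]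

/-- The degree of a pole after the swaps. -/
lemma neighborCount_swap_pole (Γ : GadgetSystem G₀ m M) (τ : Fin m → Bool)
    (h : Sym2 (Fin n) → Bool) (k : Fin m) (t : Bool) :
    (neighborCount (noisyGraph G₀ (h ∘ Γ.swapPerm τ)) (Γ.pole k t) : ℤ) =
      Γ.baseDegree h k t +
        Γ.sign k * (Γ.hits h k (t ^^ τ k) (Γ.slot k) + Γ.hits h k t (Γ.rest k)) := by
  rw [neighborCount_pole, hits_swap_slot, hits_swap_rest,
    Γ.baseDegree_congr (h := h ∘ Γ.swapPerm τ) (f := h)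
      fun e he => congrArg h (swapEdge_of_notMem_hidden τ he)]

end GadgetSystem

end GadgetSwap

section GadgetClasses

lemma bernoulliProb_forall_of_disjoint {ι κ : Type*} [Fintype ι] [DecidableEq ι] (p : ℝ)
    (s : Finset κ) (P : κ → (ι → Bool) → Prop) (I : κ → Set ι)
    (hI : ∀ k ∈ s, ∀ l ∈ s, k ≠ l → Disjoint (I k) (I l))
    (hP : ∀ k ∈ s, DependsOnCoords (P k) (I k)) :
    bernoulliProb p (fun f => ∀ k ∈ s, P k f) = ∏ k ∈ s, bernoulliProb p (P k) := by
  classical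
  unfold bernoulliProb
  rw [← bernoulliExp_prod_of_disjoint p s _ I hI]
  · congr 1
    funext f
    by_cases h : ∀ k ∈ s, P k f
    · rw [if_pos h, Finset.prod_eq_one fun k hk => if_pos (h k hk)]
    · rw [if_neg h]
      push Not at h
      obtain ⟨k, hk, hk'⟩ := h
      exact (Finset.prod_eq_zero hk (if_neg hk')).symm
  · intro k hk f g h
    simp only [hP k hk f g h]

variable {n : ℕ} {G₀ : SimpleGraph (Fin n)} {m M : ℕ}

namespace GadgetSystem

/-- The condition on the hidden edges of the gadget `k` under which swapping its slot edges
changes whether its first pole has the `j`-th target degree. -/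
def InClass (Γ : GadgetSystem G₀ m M) (h : Sym2 (Fin n) → Bool) (a j : ℕ) (k : Fin m) : Prop :=
  Γ.hits h k false (Γ.slot k) + Γ.hits h k true (Γ.slot k) = 1 ∧
    Γ.hits h k false (Γ.rest k) = 3 * j ∧ Γ.hits h k true (Γ.rest k) = a

/-- The indicator that a degree is congruent to `r` modulo `24`. -/
def degreeIndicator (r : ℤ) (d : ℕ) : ℤ := if (24 : ℤ) ∣ d - r then 1 else 0

open Classical in
lemma bernoulliProb_swap_le (Γ : GadgetSystem G₀ m M) (x : Fin n → ℤ)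
    (hx : ∀ k t, x (Γ.pole k t) ≠ 0) (h : Sym2 (Fin n) → Bool) (K : Finset (Fin m))
    (y y' ε : ℤ) (a : ℕ) (hε : ε = 1 ∨ ε = -1) (ha : (3 : ℤ) ∣ ε * (y' - y) + a - 2)
    (hy : ∀ k ∈ K, (24 : ℤ) ∣ Γ.baseDegree h k false - y)
    (hy' : ∀ k ∈ K, (24 : ℤ) ∣ Γ.baseDegree h k true - y') (hsign : ∀ k ∈ K, Γ.sign k = ε) :
    bernoulliProb (1 / 2) (fun τ => ∀ j : Fin 8,
      ∑ w, x w * degreeIndicator (y + ε * (3 * (j : ℕ) + 1))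
        (neighborCount (noisyGraph G₀ (h ∘ Γ.swapPerm τ)) w) = 0) ≤
      ∏ j : Fin 8, 1 / √((K.filter fun k => Γ.InClass h a j k).card + 1) := by
  let S : Fin 8 → Finset (Fin m) := fun j => K.filter fun k => Γ.InClass h a j k
  have hSmem : ∀ j k, k ∈ S j ↔ k ∈ K ∧ Γ.InClass h a j k := fun j k => Finset.mem_filter
  let U : Set (Fin m) := {k | ∃ j, k ∈ S j}
  have half0 : (0 : ℝ) ≤ 1 / 2 := by norm_num
  have half1 : (1 / 2 : ℝ) ≤ 1 := by norm_num
  unfold bernoulliProb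
  rw [bernoulliExp_resample (1 / 2) (fun _ => Uᶜ) (fun _ _ _ => rfl)]
  refine bernoulliExp_le_const half0 half1 fun τ₀ => ?_
  let T : Fin 8 → (Fin m → Bool) → Fin n → ℤ := fun j τ w =>
    degreeIndicator (y + ε * (3 * (j : ℕ) + 1))
      (neighborCount (noisyGraph G₀ (h ∘ Γ.swapPerm (splice Uᶜ τ₀ τ))) w)
  have hdeg : ∀ τ k t, (neighborCount (noisyGraph G₀ (h ∘ Γ.swapPerm τ)) (Γ.pole k t) : ℤ) = _ :=
    fun τ k t => Γ.neighborCount_swap_pole τ h k t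
  have htrue : ∀ j j' k τ, k ∈ S j' → T j τ (Γ.pole k true) = 0 := by
    intro j j' k τ hk
    obtain ⟨hK, h1, h2, h3⟩ := (hSmem j' k).1 hk
    simp only [T, degreeIndicator, hdeg, hsign k hK, h3, ite_eq_right_iff]
    have e1 := hy' k hK
    intro hd
    exfalso
    have hle : Γ.hits h k (true ^^ splice Uᶜ τ₀ τ k) (Γ.slot k) ≤ 1 := by
      cases (true ^^ splice Uᶜ τ₀ τ k) <;> omega
    generalize Γ.hits h k (true ^^ splice Uᶜ τ₀ τ k) (Γ.slot k) = z at hd hle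
    rcases hε with rfl | rfl <;> omega
  have hfalse : ∀ j j' k τ, k ∈ S j' → T j τ (Γ.pole k false) =
      if j = j' ∧ Γ.hits h k (τ k) (Γ.slot k) = 1 then 1 else 0 := by
    intro j j' k τ hk
    obtain ⟨hK, h1, h2, h3⟩ := (hSmem j' k).1 hk
    have hsp : splice Uᶜ τ₀ τ k = τ k := splice_of_notMem fun h => h ⟨j', hk⟩
    simp only [T, degreeIndicator, hdeg, hsign k hK, h2, hsp, Bool.false_xor]
    have e1 := hy k hK
    have hle : Γ.hits h k (τ k) (Γ.slot k) ≤ 1 := by cases τ k <;> omega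
    generalize Γ.hits h k (τ k) (Γ.slot k) = z at hle ⊢
    have hj := j.2
    have hj' := j'.2
    have hjj : j = j' ↔ (j : ℕ) = j' := Fin.ext_iff
    congr 1
    rw [hjj, eq_iff_iff]
    push_cast
    rcases hε with rfl | rfl <;> omega
  have hother : ∀ j τ w, (∀ k ∈ S j, w ≠ Γ.pole k false) → T j τ w = T j (fun _ => false) w := by
    intro j τ w hw
    by_cases hp : ∃ k t, w = Γ.pole k t
    · obtain ⟨k, t, rfl⟩ := hp
      by_cases hU : k ∈ U
      · obtain ⟨j', hk⟩ := hU
        cases t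
        · have hne : j ≠ j' := by
            rintro rfl
            exact hw k hk rfl
          rw [hfalse j j' k _ hk, hfalse j j' k _ hk]
          simp [hne]
        · rw [htrue j j' k _ hk, htrue j j' k _ hk]
      · have e : ∀ τ, splice Uᶜ τ₀ τ k = τ₀ k := fun τ => splice_of_mem hU
        simp only [T, degreeIndicator, hdeg, e]
    · push Not at hp
      simp only [T, neighborCount_swap_of_not_pole Γ _ h w hp]
  let α : Fin m → ℤ := fun k => x (Γ.pole k false) *
    (Γ.hits h k true (Γ.slot k) - Γ.hits h k false (Γ.slot k))
  have hsum : ∀ j τ, ∑ w, x w * T j τ w = (∑ w, x w * T j (fun _ => false) w) +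
      ∑ k ∈ S j, if τ k then α k else 0 := by
    intro j τ
    rw [← sub_eq_iff_eq_add', ← Finset.sum_sub_distrib]
    have hinj : Set.InjOn (fun k => Γ.pole k false) (S j) := fun k _ k' _ hkk =>
      (Γ.pole_inj _ _ _ _ hkk).1
    rw [← Finset.sum_subset (Finset.subset_univ ((S j).image fun k => Γ.pole k false)),
      Finset.sum_image hinj]
    · refine Finset.sum_congr rfl fun k hk => ?_
      rw [hfalse j j k _ hk, hfalse j j k _ hk]
      obtain ⟨-, h1, -⟩ := (hSmem j k).1 hk
      simp only [true_and, α]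
      cases τ k
      · simp
      · have : Γ.hits h k true (Γ.slot k) = 1 ∧ Γ.hits h k false (Γ.slot k) = 0 ∨
            Γ.hits h k true (Γ.slot k) = 0 ∧ Γ.hits h k false (Γ.slot k) = 1 := by omega
        rcases this with ⟨e1, e2⟩ | ⟨e1, e2⟩ <;> simp [e1, e2]
    · intro w _ hw
      rw [hother j τ w, sub_self]
      intro k hk hwk
      exact hw (Finset.mem_image.2 ⟨k, hk, hwk.symm⟩)
  have hα : ∀ j, ∀ k ∈ S j, α k ≠ 0 := by
    intro j k hk
    obtain ⟨-, h1, -⟩ := (hSmem j k).1 hk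
    exact mul_ne_zero (hx k false) (by omega)
  have hP : bernoulliProb (1 / 2) (fun τ => ∀ j ∈ (Finset.univ : Finset (Fin 8)),
      ∑ k ∈ S j, (if τ k then α k else 0) = -∑ w, x w * T j (fun _ => false) w) ≤
      ∏ j : Fin 8, 1 / √((S j).card + 1) := by
    rw [bernoulliProb_forall_of_disjoint (1 / 2) Finset.univ
      (fun j τ => ∑ k ∈ S j, (if τ k then α k else 0) = -∑ w, x w * T j (fun _ => false) w)
      (fun j => (S j : Set (Fin m)))]
    · exact Finset.prod_le_prod (fun j _ => bernoulliProb_nonneg half0 half1 _) fun j _ =>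
        bernoulliProb_half_sum_eq_le (S j) α (hα j) _
    · intro j _ j' _ hne
      rw [Finset.disjoint_coe, Finset.disjoint_left]
      intro k hk hk'
      have h1 := ((hSmem j k).1 hk).2.2.1
      have h2 := ((hSmem j' k).1 hk').2.2.1
      exact hne (Fin.ext (by omega))
    · intro j _ τ τ' hτ
      have : ∑ k ∈ S j, (if τ k then α k else 0) = ∑ k ∈ S j, if τ' k then α k else 0 :=
        Finset.sum_congr rfl fun k hk => by rw [hτ k hk]
      simp only [this]
  refine le_trans (le_of_eq ?_) hP
  unfold bernoulliProb
  congr 1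
  funext τ
  congr 1
  rw [eq_iff_iff]
  refine forall_congr' fun j => ?_
  rw [show (∑ w, x w * degreeIndicator (y + ε * (3 * (j : ℕ) + 1))
    (neighborCount (noisyGraph G₀ (h ∘ Γ.swapPerm (splice Uᶜ τ₀ τ))) w)) =
    ∑ w, x w * T j τ w from rfl, hsum j τ]
  constructor
  · intro he _
    linarith
  · intro he
    linarith [he (Finset.mem_univ j)]

end GadgetSystem

end GadgetClasses

section GadgetClassProbability

variable {n : ℕ} {G₀ : SimpleGraph (Fin n)} {m M : ℕ}

namespace GadgetSystem

/-- The hidden edges of a single gadget. -/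
def block (Γ : GadgetSystem G₀ m M) (k : Fin m) : Set (Sym2 (Fin n)) :=
  {e | ∃ t, ∃ c ∈ Γ.slot k ∪ Γ.rest k, e = s(Γ.pole k t, c)}

lemma block_subset_hidden (Γ : GadgetSystem G₀ m M) (k : Fin m) : Γ.block k ⊆ Γ.hidden :=
  fun _ ⟨t, c, hc, he⟩ => ⟨k, t, c, hc, he⟩

lemma eq_of_mk_pole_eq (Γ : GadgetSystem G₀ m M) {k k' : Fin m} {t t' : Bool} {c c' : Fin n}
    (hc' : c' ∈ Γ.slot k' ∪ Γ.rest k') (h : s(Γ.pole k t, c) = s(Γ.pole k' t', c')) :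
    k = k' ∧ t = t' ∧ c = c' := by
  rcases Sym2.eq_iff.1 h with ⟨h1, rfl⟩ | ⟨h1, -⟩
  · obtain ⟨rfl, rfl⟩ := Γ.pole_inj _ _ _ _ h1
    exact ⟨rfl, rfl, rfl⟩
  · exact absurd (h1 ▸ hc') (Γ.pole_notMem k t k')

lemma disjoint_block (Γ : GadgetSystem G₀ m M) {k l : Fin m} (hkl : k ≠ l) :
    Disjoint (Γ.block k) (Γ.block l) := by
  rw [Set.disjoint_left]
  rintro e ⟨t, c, -, rfl⟩ ⟨t', c', hc', he⟩
  exact hkl (Γ.eq_of_mk_pole_eq hc' he).1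

lemma hits_congr (Γ : GadgetSystem G₀ m M) {f h : Sym2 (Fin n) → Bool} {k : Fin m}
    (hfh : ∀ e ∈ Γ.block k, f e = h e) (t : Bool) {A : Finset (Fin n)}
    (hA : A ⊆ Γ.slot k ∪ Γ.rest k) : Γ.hits f k t A = Γ.hits h k t A := by
  classical
  unfold hits
  congr 1
  exact Finset.filter_congr fun c hc => by rw [hfh _ ⟨t, c, hA hc, rfl⟩]

lemma dependsOnCoords_inClass (Γ : GadgetSystem G₀ m M) (a j : ℕ) (k : Fin m) :
    DependsOnCoords (fun h => Γ.InClass h a j k) (Γ.block k) := by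
  intro f h hfh
  simp only [InClass, Γ.hits_congr hfh _ Finset.subset_union_left,
    Γ.hits_congr hfh _ Finset.subset_union_right]

open Classical in
/-- The potential edges between a pole and a set of vertices. -/
noncomputable def link (Γ : GadgetSystem G₀ m M) (k : Fin m) (t : Bool) (A : Finset (Fin n)) :
    Finset (Sym2 (Fin n)) := A.image fun c => s(Γ.pole k t, c)

lemma mem_link (Γ : GadgetSystem G₀ m M) {k : Fin m} {t : Bool} {A : Finset (Fin n)}
    {e : Sym2 (Fin n)} : e ∈ Γ.link k t A ↔ ∃ c ∈ A, s(Γ.pole k t, c) = e := by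
  simp [link]

lemma card_link (Γ : GadgetSystem G₀ m M) (k : Fin m) (t : Bool) (A : Finset (Fin n)) :
    (Γ.link k t A).card = A.card := by
  classical
  exact Finset.card_image_of_injective _ fun c c' h => Sym2.congr_right.1 h

open Classical in
lemma card_filter_link (Γ : GadgetSystem G₀ m M) (h : Sym2 (Fin n) → Bool) (k : Fin m) (t : Bool)
    (A : Finset (Fin n)) :
    ((Γ.link k t A).filter fun e => h e = true).card = Γ.hits h k t A := by
  unfold link hits
  rw [Finset.filter_image, Finset.card_image_of_injective _ fun c c' h => Sym2.congr_right.1 h]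

lemma disjoint_link (Γ : GadgetSystem G₀ m M) {k : Fin m} {t t' : Bool} {A A' : Finset (Fin n)}
    (hA' : A' ⊆ Γ.slot k ∪ Γ.rest k) (h : t ≠ t' ∨ Disjoint A A') :
    Disjoint (Γ.link k t A) (Γ.link k t' A') := by
  rw [Finset.disjoint_left]
  intro e he he'
  obtain ⟨c, hc, rfl⟩ := (Γ.mem_link).1 he
  obtain ⟨c', hc', h'⟩ := (Γ.mem_link).1 he'
  obtain ⟨-, rfl, rfl⟩ := Γ.eq_of_mk_pole_eq (hA' hc') h'.symm
  rcases h with h | h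
  · exact h rfl
  · exact Finset.disjoint_left.1 h hc hc'

open Classical in
lemma _root_.DependsOnCoords.indicator {ι : Type*} {P : (ι → Bool) → Prop} {I : Set ι}
    (hP : DependsOnCoords P I) : DependsOnCoords (fun f => if P f then (1 : ℝ) else 0) I := by
  intro f g hfg
  have h := hP f g hfg
  beta_reduce
  by_cases hf : P f
  · rw [if_pos hf, if_pos (h ▸ hf)]
  · rw [if_neg hf, if_neg (h ▸ hf)]

lemma _root_.bernoulliProb_card_eq_and {ι : Type*} [Fintype ι] [DecidableEq ι] (p : ℝ)
    (Y Y' : Finset ι)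
    (hY : Disjoint Y Y') (a : ℕ) (P : (ι → Bool) → Prop) (hP : DependsOnCoords P (Y' : Set ι)) :
    bernoulliProb p (fun f => (Y.filter fun i => f i = true).card = a ∧ P f) =
      (Y.card.choose a * p ^ a * (1 - p) ^ (Y.card - a)) * bernoulliProb p P := by
  rw [← bernoulliProb_card_eq]
  unfold bernoulliProb
  rw [← bernoulliExp_mul_of_disjoint p (Finset.disjoint_coe.2 hY)]
  · congr 1
    funext f
    by_cases h1 : (Y.filter fun i => f i = true).card = a <;> by_cases h2 : P f <;>
      simp [h1, h2]
  · refine DependsOnCoords.indicator fun f g hfg => ?_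
    have : (Y.filter fun i => f i = true) = Y.filter fun i => g i = true :=
      Finset.filter_congr fun i hi => by rw [hfg i hi]
    simp only [this]
  · exact DependsOnCoords.indicator hP

/-- A uniform lower bound for the probability that a gadget belongs to a given class. -/
lemma pow_three_le_bernoulliProb_inClass (Γ : GadgetSystem G₀ m M) {p q : ℝ} (hq0 : 0 ≤ q)
    {a j : ℕ} (hslot : q ≤ (2 * M : ℕ) * p * (1 - p) ^ (2 * M - 1))
    (hj : q ≤ M.choose (3 * j) * p ^ (3 * j) * (1 - p) ^ (M - 3 * j))
    (ha : q ≤ M.choose a * p ^ a * (1 - p) ^ (M - a)) (k : Fin m) :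
    q ^ 3 ≤ bernoulliProb p (fun h => Γ.InClass h a j k) := by
  classical
  have hsl := Finset.subset_union_left (s₁ := Γ.slot k) (s₂ := Γ.rest k)
  have hre := Finset.subset_union_right (s₁ := Γ.slot k) (s₂ := Γ.rest k)
  let Y₁ := Γ.link k false (Γ.slot k) ∪ Γ.link k true (Γ.slot k)
  let Y₂ := Γ.link k false (Γ.rest k)
  let Y₃ := Γ.link k true (Γ.rest k)
  have d0 : Disjoint (Γ.link k false (Γ.slot k)) (Γ.link k true (Γ.slot k)) :=
    Γ.disjoint_link hsl (Or.inl (by decide))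
  have d1 : Disjoint Y₁ (Y₂ ∪ Y₃) := by
    simp only [Y₁, Y₂, Y₃, Finset.disjoint_union_left, Finset.disjoint_union_right]
    exact ⟨⟨Γ.disjoint_link hre (Or.inr (Γ.disjoint k)),
      Γ.disjoint_link hre (Or.inr (Γ.disjoint k))⟩,
      Γ.disjoint_link hre (Or.inr (Γ.disjoint k)), Γ.disjoint_link hre (Or.inr (Γ.disjoint k))⟩
  have d2 : Disjoint Y₂ Y₃ := Γ.disjoint_link hre (Or.inl (by decide))
  have c1 : Y₁.card = 2 * M := by
    rw [Finset.card_union_of_disjoint d0, card_link, card_link, Γ.card_slot, two_mul]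
  have c2 : Y₂.card = M := by rw [card_link, Γ.card_rest]
  have c3 : Y₃.card = M := by rw [card_link, Γ.card_rest]
  have hcongr : ∀ Y : Finset (Sym2 (Fin n)), ∀ f g : Sym2 (Fin n) → Bool, (∀ i ∈ Y, f i = g i) →
      (Y.filter fun i => f i = true) = Y.filter fun i => g i = true := fun Y f g hfg =>
    Finset.filter_congr fun i hi => by rw [hfg i hi]
  have hclass : (fun h => Γ.InClass h a j k) = fun h => (Y₁.filter fun e => h e = true).card = 1 ∧
      (Y₂.filter fun e => h e = true).card = 3 * j ∧
      (Y₃.filter fun e => h e = true).card = a := by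
    funext h
    simp only [Y₁, Y₂, Y₃, InClass]
    rw [Finset.filter_union, Finset.card_union_of_disjoint
      (Finset.disjoint_filter_filter d0)]
    simp only [card_filter_link]
  rw [hclass, bernoulliProb_card_eq_and p Y₁ (Y₂ ∪ Y₃) d1,
    bernoulliProb_card_eq_and p Y₂ Y₃ d2, bernoulliProb_card_eq, c1, c2, c3]
  · rw [Nat.choose_one_right, pow_one]
    have h2 := mul_le_mul hj ha hq0 (hq0.trans hj)
    have h3 := mul_le_mul hslot h2 (mul_nonneg hq0 hq0) (hq0.trans hslot)
    calc q ^ 3 = q * (q * q) := by ring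
      _ ≤ _ := h3
  · intro f g hfg
    simp only [hcongr Y₃ f g hfg]
  · intro f g hfg
    simp only [hcongr Y₂ f g fun i hi => hfg i (Finset.mem_coe.2 (Finset.mem_union_left _ hi)),
      hcongr Y₃ f g fun i hi => hfg i (Finset.mem_coe.2 (Finset.mem_union_right _ hi))]

/-- Every class is likely to contain a positive proportion of a given set of gadgets. -/
lemma bernoulliProb_few_inClass_le (Γ : GadgetSystem G₀ m M) {p q : ℝ} (h0 : 0 ≤ p) (h1 : p ≤ 1)
    (hq0 : 0 ≤ q) {a j : ℕ} (K : Finset (Fin m)) [∀ h, DecidablePred fun k => Γ.InClass h a j k]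
    (hq : ∀ k, q ≤ bernoulliProb p (fun h => Γ.InClass h a j k)) :
    bernoulliProb p (fun h => ((K.filter fun k => Γ.InClass h a j k).card : ℝ) ≤
      q * K.card / 4) ≤ Real.exp (-(q * K.card / 4)) := by
  have he : Real.exp (-1) ≤ 1 / 2 := by
    rw [Real.exp_neg]
    have h2 := Real.add_one_le_exp (1 : ℝ)
    rw [inv_le_comm₀ (Real.exp_pos 1) (by norm_num)]
    norm_num at h2 ⊢
    exact h2
  have hE := bernoulliExp_exp_neg_count_le h0 h1 1 q zero_le_one K
    (fun k h => Γ.InClass h a j k) Γ.block (fun k _ l _ hkl => Γ.disjoint_block hkl)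
    (fun k _ => Γ.dependsOnCoords_inClass a j k) (fun k _ => hq k)
  refine (bernoulliProb_le_of_exp h0 h1 (Real.exp (q * K.card / 4))
    (φ := fun f => Real.exp (-1 * (K.filter fun k => Γ.InClass f a j k).card))
    (fun f => (Real.exp_pos _).le) ?_ (Real.exp_pos _).le).trans ?_
  · intro f hf
    rw [← Real.exp_add]
    exact Real.one_le_exp (by linarith)
  · refine (mul_le_mul_of_nonneg_left hE (Real.exp_pos _).le).trans ?_
    rw [← Real.exp_add, Real.exp_le_exp]
    have : 0 ≤ K.card * q := by positivity
    nlinarith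
end GadgetSystem

end GadgetClassProbability

section Endgame

variable {n : ℕ} {G₀ : SimpleGraph (Fin n)} {m M : ℕ}

namespace GadgetSystem

lemma exists_baseDegree_fiber (Γ : GadgetSystem G₀ m M) (f : Sym2 (Fin n) → Bool) :
    ∃ (K : Finset (Fin m)) (y y' ε : ℤ) (a : ℕ), (m : ℝ) / 1152 ≤ K.card ∧ (ε = 1 ∨ ε = -1) ∧
      a ≤ 2 ∧ (3 : ℤ) ∣ ε * (y' - y) + a - 2 ∧ (∀ k ∈ K, (24 : ℤ) ∣ Γ.baseDegree f k false - y) ∧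
      (∀ k ∈ K, (24 : ℤ) ∣ Γ.baseDegree f k true - y') ∧ ∀ k ∈ K, Γ.sign k = ε := by
  classical
  let φ : Fin m → ZMod 24 × ZMod 24 × Bool := fun k =>
    ((Γ.baseDegree f k false : ℤ), (Γ.baseDegree f k true : ℤ), Γ.sgn k)
  obtain ⟨z, hz⟩ := Fintype.exists_le_card_fiber_of_nsmul_le_card φ (b := (m : ℝ) / 1152) (by
    simp only [Fintype.card_prod, ZMod.card, Fintype.card_bool, Fintype.card_fin, nsmul_eq_mul]
    push_cast
    linarith)
  have hdvd : ∀ (d : ℤ) (c : ZMod 24), (d : ZMod 24) = c → (24 : ℤ) ∣ d - (c.val : ℤ) := by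
    intro d c h
    have h2 : (((c.val : ℤ)) : ZMod 24) = (d : ZMod 24) := by
      rw [h]
      simp
    exact (ZMod.intCast_eq_intCast_iff_dvd_sub _ _ 24).1 h2
  let ε : ℤ := if z.2.2 then -1 else 1
  have hε : ε = 1 ∨ ε = -1 := by
    simp only [ε]
    split_ifs <;> simp
  obtain ⟨a, ha2, ha⟩ : ∃ a : ℕ, a ≤ 2 ∧
      (3 : ℤ) ∣ ε * ((z.2.1.val : ℤ) - z.1.val) + a - 2 := by
    generalize ε * ((z.2.1.val : ℤ) - z.1.val) = c
    refine ⟨((2 - c) % 3).toNat, ?_, ?_⟩ <;> omega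
  refine ⟨Finset.univ.filter fun k => φ k = z, z.1.val, z.2.1.val, ε, a, hz, hε, ha2, ha,
    ?_, ?_, ?_⟩ <;> intro k hk <;> have hk := (Finset.mem_filter.1 hk).2
  · exact hdvd _ _ (congrArg (fun z => z.1) hk)
  · exact hdvd _ _ (congrArg (fun z => z.2.1) hk)
  · have : Γ.sgn k = z.2.2 := congrArg (fun z => z.2.2) hk
    simp only [ε, sign, this]

/-- Resampling the hidden edges, it is unlikely that every degree statistic of `x` vanishes. -/
lemma bernoulliProb_splice_hidden_le (Γ : GadgetSystem G₀ m M) {p q L : ℝ} (h0 : 0 ≤ p)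
    (h1 : p ≤ 1) (hq0 : 0 ≤ q) (hL : 0 < L) (hLm : L ≤ q * m / 4608)
    (hq : ∀ a ≤ 2, ∀ j < 8, ∀ k, q ≤ bernoulliProb p (fun h => Γ.InClass h a j k))
    (x : Fin n → ℤ) (hx : ∀ k t, x (Γ.pole k t) ≠ 0) (f : Sym2 (Fin n) → Bool) :
    bernoulliProb p (fun g => ∀ r : ℤ, ∑ w, x w * degreeIndicator r
      (neighborCount (noisyGraph G₀ (splice Γ.hiddenᶜ f g)) w) = 0) ≤ 193 / L ^ 4 := by
  classical
  obtain ⟨K, y, y', ε, a, hK, hε, ha2, ha, hy, hy', hs⟩ := Γ.exists_baseDegree_fiber f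
  have hLK : L ≤ q * K.card / 4 := by
    have := mul_le_mul_of_nonneg_left hK hq0
    linarith
  have half0 : (0 : ℝ) ≤ 1 / 2 := by norm_num
  have half1 : (1 / 2 : ℝ) ≤ 1 := by norm_num
  let Φ : (Sym2 (Fin n) → Bool) → ℝ := fun h => if ∀ j : Fin 8,
    ∑ w, x w * degreeIndicator (y + ε * (3 * (j : ℕ) + 1))
      (neighborCount (noisyGraph G₀ h) w) = 0 then 1 else 0
  let few : ℕ → (Sym2 (Fin n) → Bool) → Prop := fun j g =>
    ((K.filter fun k => Γ.InClass g a j k).card : ℝ) ≤ q * K.card / 4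
  have hswap : ∀ τ : Fin m → Bool, bernoulliExp p (fun g => Φ (splice Γ.hiddenᶜ f g)) =
      bernoulliExp p fun g => Φ (splice Γ.hiddenᶜ f g ∘ Γ.swapPerm τ) := by
    intro τ
    rw [← bernoulliExp_comp_perm p (Γ.swapPerm τ)]
    simp only [splice_comp_swapPerm]
  have hexp : bernoulliExp p (fun g => Φ (splice Γ.hiddenᶜ f g)) = bernoulliExp p fun g =>
      bernoulliExp (1 / 2) fun τ => Φ (splice Γ.hiddenᶜ f g ∘ Γ.swapPerm τ) := by
    rw [bernoulliExp_comm]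
    simp only [← hswap, bernoulliExp_const]
  have hbound : ∀ g, bernoulliExp (1 / 2)
      (fun τ => Φ (splice Γ.hiddenᶜ f g ∘ Γ.swapPerm τ)) ≤
      (if ∃ j ∈ Finset.range 8, few j g then 1 else 0) + 1 / L ^ 4 := by
    intro g
    have hoff : ∀ e ∉ Γ.hidden, splice Γ.hiddenᶜ f g e = f e := fun e he => splice_of_mem he
    have hon : ∀ e ∈ Γ.hidden, splice Γ.hiddenᶜ f g e = g e := fun e he =>
      splice_of_notMem fun h => h he
    have hb := Γ.bernoulliProb_swap_le x hx (splice Γ.hiddenᶜ f g) K y y' ε a hε ha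
      (fun k hk => by rw [Γ.baseDegree_congr hoff]; exact hy k hk)
      (fun k hk => by rw [Γ.baseDegree_congr hoff]; exact hy' k hk) hs
    rw [bernoulliProb_eq] at hb
    have hcls : ∀ j : ℕ, (K.filter fun k => Γ.InClass (splice Γ.hiddenᶜ f g) a j k) =
        K.filter fun k => Γ.InClass g a j k := by
      intro j
      refine Finset.filter_congr fun k _ => ?_
      rw [← eq_iff_iff]
      exact Γ.dependsOnCoords_inClass a j k _ _ fun e he => hon e (Γ.block_subset_hidden k he)
    refine hb.trans ?_
    have hL4 : 0 ≤ 1 / L ^ 4 := by positivity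
    split_ifs with hfew
    · have : ∏ j : Fin 8, 1 / √(((K.filter fun k =>
          Γ.InClass (splice Γ.hiddenᶜ f g) a j k).card : ℝ) + 1) ≤ 1 := by
        refine Finset.prod_le_one (fun j _ => by positivity) fun j _ => ?_
        rw [div_le_one (by positivity), Real.one_le_sqrt]
        simp
      linarith
    · rw [zero_add]
      have hprod : ∏ j : Fin 8, 1 / √(((K.filter fun k =>
          Γ.InClass (splice Γ.hiddenᶜ f g) a j k).card : ℝ) + 1) ≤ ∏ j : Fin 8, 1 / √L := by
        refine Finset.prod_le_prod (fun j _ => by positivity) fun j _ => ?_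
        refine one_div_le_one_div_of_le (Real.sqrt_pos.2 hL) (Real.sqrt_le_sqrt ?_)
        rw [hcls]
        push Not at hfew
        have := hfew j (Finset.mem_range.2 j.2)
        simp only [few] at this
        push Not at this
        linarith
      refine hprod.trans (le_of_eq ?_)
      rw [Finset.prod_const, Finset.card_univ, Fintype.card_fin, one_div_pow]
      congr 1
      rw [show 8 = 2 * 4 from rfl, pow_mul, Real.sq_sqrt hL.le]
  have hfew : bernoulliProb p (fun g => ∃ j ∈ Finset.range 8, few j g) ≤ 8 * Real.exp (-L) := by
    refine (bernoulliProb_exists_le h0 h1 _ _).trans ?_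
    have : ∀ j ∈ Finset.range 8, bernoulliProb p (few j) ≤ Real.exp (-L) := by
      intro j hj
      refine (Γ.bernoulliProb_few_inClass_le h0 h1 hq0 K
        (hq a ha2 j (Finset.mem_range.1 hj))).trans ?_
      exact Real.exp_le_exp.2 (neg_le_neg hLK)
    refine (Finset.sum_le_sum this).trans (le_of_eq ?_)
    simp
  have hexpL : Real.exp (-L) ≤ 24 / L ^ 4 := by
    have h2 := Real.pow_div_factorial_le_exp L hL.le 4
    rw [Real.exp_neg, inv_le_comm₀ (Real.exp_pos L) (by positivity), inv_div]
    exact h2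
  calc bernoulliProb p (fun g => ∀ r : ℤ, ∑ w, x w * degreeIndicator r
      (neighborCount (noisyGraph G₀ (splice Γ.hiddenᶜ f g)) w) = 0)
      ≤ bernoulliExp p (fun g => Φ (splice Γ.hiddenᶜ f g)) := by
        rw [← bernoulliProb_eq p (fun g => ∀ j : Fin 8,
          ∑ w, x w * degreeIndicator (y + ε * (3 * (j : ℕ) + 1))
            (neighborCount (noisyGraph G₀ (splice Γ.hiddenᶜ f g)) w) = 0)]
        exact bernoulliProb_mono h0 h1 fun g h j => h _
    _ ≤ bernoulliExp p (fun g => (if ∃ j ∈ Finset.range 8, few j g then 1 else 0) + 1 / L ^ 4) := by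
        rw [hexp]
        exact bernoulliExp_mono h0 h1 hbound
    _ = bernoulliProb p (fun g => ∃ j ∈ Finset.range 8, few j g) + 1 / L ^ 4 := by
        rw [bernoulliExp_add, bernoulliExp_const, bernoulliProb_eq]
    _ ≤ 8 * (24 / L ^ 4) + 1 / L ^ 4 := by
        gcongr
        exact hfew.trans (by gcongr)
    _ = 193 / L ^ 4 := by ring

end GadgetSystem

end Endgame

section Indistinguishable

variable {n : ℕ}

/-- The property of the two sets making it possible to find gadgets with poles in `X`, none of
whose other vertices lies in `Z`. -/
def HasGadgets (G₀ : SimpleGraph (Fin n)) (m M : ℕ) (Z X : Set (Fin n)) : Prop :=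
  ∃ Γ : GadgetSystem G₀ m M, (∀ k t, Γ.pole k t ∈ X) ∧ ∀ k, ∀ c ∈ Γ.slot k ∪ Γ.rest k, c ∉ Z

open Classical in
/-- The hidden edges of a chosen system of gadgets, if there is one. -/
noncomputable def chosenHidden (G₀ : SimpleGraph (Fin n)) (m M : ℕ) (Z X : Set (Fin n)) :
    Set (Sym2 (Fin n)) :=
  if h : HasGadgets G₀ m M Z X then h.choose.hidden else ∅

lemma notMem_chosenHidden {G₀ : SimpleGraph (Fin n)} {m M : ℕ} {Z X : Set (Fin n)}
    (hZX : Disjoint Z X) {e : Sym2 (Fin n)} (he : e ∈ edgesTouching Z) :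
    e ∉ chosenHidden G₀ m M Z X := by
  intro h
  unfold chosenHidden at h
  split_ifs at h with hΓ
  · obtain ⟨k, t, c, hc, rfl⟩ := h
    obtain ⟨h1, h2⟩ := hΓ.choose_spec
    rcases mk_mem_edgesTouching.1 he with h3 | h3
    · exact Set.disjoint_left.1 hZX h3 (h1 k t)
    · exact h2 k c hc h3
  · exact h

lemma hasGadgets_of_ncard_le (G₀ : SimpleGraph (Fin n)) {m M : ℕ} {Z X : Set (Fin n)}
    (hX : 3 * m ≤ X.ncard) (hZ : Z.ncard + 3 * m + 12 * M ≤ n) : HasGadgets G₀ m M Z X := by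
  classical
  rw [Set.ncard_eq_toFinset_card'] at hX hZ
  obtain ⟨Γ, h1, h2⟩ := exists_gadgetSystem G₀ m M Z.toFinset X.toFinset hX hZ
  refine ⟨Γ, fun k t => Set.mem_toFinset.1 (h1 k t), fun k c hc hcZ => ?_⟩
  exact Finset.disjoint_left.1 (h2 k) hc (Set.mem_toFinset.2 hcZ)

/-- It is unlikely that two vertices get the same stable colour although some layer of their walk
difference is large while the preceding layers do not occupy too many vertices. -/
lemma bernoulliProb_crStableTrivial_large_layer_le {p q L : ℝ} (h0 : 0 ≤ p) (h1 : p ≤ 1)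
    (hq0 : 0 ≤ q) {m M : ℕ} (hL : 0 < L) (hLm : L ≤ q ^ 3 * m / 4608)
    (hslot : q ≤ (2 * M : ℕ) * p * (1 - p) ^ (2 * M - 1))
    (hrest : ∀ b ≤ 21, q ≤ M.choose b * p ^ b * (1 - p) ^ (M - b))
    (G₀ : SimpleGraph (Fin n)) {u v : Fin n} (huv : u ≠ v) (i : ℕ) :
    bernoulliProb p (fun f => crStableTrivial (noisyGraph G₀ f) u v ∧
      3 * m ≤ (Sat (noisyGraph G₀ f) u v i).ncard ∧
      (Sbelow (noisyGraph G₀ f) u v i).ncard + 3 * m + 12 * M ≤ n) ≤ 193 / L ^ 4 := by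
  classical
  let Z : (Sym2 (Fin n) → Bool) → Set (Fin n) := fun f => Sbelow (noisyGraph G₀ f) u v i
  let X : (Sym2 (Fin n) → Bool) → Set (Fin n) := fun f => Sat (noisyGraph G₀ f) u v i
  have hZX : ∀ f, Disjoint (Z f) (X f) := fun f => disjoint_sdiff_self_right
  let F : (Sym2 (Fin n) → Bool) → Set (Sym2 (Fin n)) := fun f =>
    (chosenHidden G₀ m M (Z f) (X f))ᶜ
  have htouch : ∀ f g : Sym2 (Fin n) → Bool, (∀ e ∈ F f, g e = f e) →
      ∀ e ∈ edgesTouching (Z f), g e = f e := fun f g h e he =>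
    h e (notMem_chosenHidden (hZX f) he)
  have hZeq : ∀ f g : Sym2 (Fin n) → Bool, (∀ e ∈ F f, g e = f e) → Z g = Z f := fun f g h =>
    Sbelow_noisyGraph_congr G₀ huv i (htouch f g h) i (Nat.le_succ i)
  have hXeq : ∀ f g : Sym2 (Fin n) → Bool, (∀ e ∈ F f, g e = f e) → X g = X f := fun f g h =>
    congrArg₂ (· \ ·) (Sbelow_noisyGraph_congr G₀ huv i (htouch f g h) (i + 1) le_rfl)
      (hZeq f g h)
  have hF : ∀ f g : Sym2 (Fin n) → Bool, (∀ e ∈ F f, g e = f e) → F g = F f := by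
    intro f g h
    simp only [F, hZeq f g h, hXeq f g h]
  rw [bernoulliProb, bernoulliExp_resample p F hF]
  refine bernoulliExp_le_const h0 h1 fun f => ?_
  have hagree : ∀ g, ∀ e ∈ F f, splice (F f) f g e = f e := fun g e he => splice_of_mem he
  by_cases hG : HasGadgets G₀ m M (Z f) (X f)
  · have hFf : F f = hG.choose.hiddenᶜ := by simp only [F, chosenHidden, dif_pos hG]
    obtain ⟨hpole, -⟩ := hG.choose_spec
    have hb := hG.choose.bernoulliProb_splice_hidden_le h0 h1 (pow_nonneg hq0 3) hL hLm
      (fun a ha j hj k => hG.choose.pow_three_le_bernoulliProb_inClass hq0 hslot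
        (hrest (3 * j) (by omega)) (hrest a (by omega)) k)
      (walkDiff (noisyGraph G₀ f) u v i)
      (fun k t => ((mem_Sat_iff _ huv i _).1 (hpole k t)).2) f
    rw [← hFf] at hb
    refine le_trans ?_ hb
    change bernoulliProb p (fun g => crStableTrivial (noisyGraph G₀ (splice (F f) f g)) u v ∧
      3 * m ≤ (Sat (noisyGraph G₀ (splice (F f) f g)) u v i).ncard ∧
      (Sbelow (noisyGraph G₀ (splice (F f) f g)) u v i).ncard + 3 * m + 12 * M ≤ n) ≤ _
    refine bernoulliProb_mono h0 h1 fun g hg r => ?_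
    rw [← walkDiff_noisyGraph_congr G₀ huv i (htouch f _ (hagree g)) i le_rfl]
    exact sum_walkDiff_neighborCount hg.1 i (GadgetSystem.degreeIndicator r)
  · have hle : (0 : ℝ) ≤ 193 / L ^ 4 := by positivity
    refine (bernoulliExp_le_const h0 h1 fun g => ?_).trans hle
    rw [if_neg]
    rintro ⟨-, h2, h3⟩
    have e1 := hZeq f _ (hagree g)
    have e2 := hXeq f _ (hagree g)
    refine hG ?_
    rw [← e1, ← e2]
    exact hasGadgets_of_ncard_le G₀ h2 h3

end Indistinguishable

section UnionBound

variable {n : ℕ}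

lemma exists_large_layer {θ κ N t T : ℝ} (hκ : 0 ≤ κ) (hN0 : 0 < N) (hT : t ≤ κ * T)
    (hθ : 0 < θ) {m : ℕ} (hm : θ * (3 * m) ≤ κ * (N / 2) - t) (hm' : (3 * m : ℝ) ≤ N / 2)
    (G : SimpleGraph (Fin n)) {u v : Fin n} (huv : u ≠ v)
    (hgrow : ∀ i ≤ n, ((Sbelow G u v i).ncard : ℝ) < N →
      κ * (Sbelow G u v i).ncard - θ * (Sat G u v i).ncard < t)
    (hlarge : ∃ i, T ≤ (Nat.card ↥(Sle G u v i) : ℝ)) :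
    ∃ i ≤ n, ((Sbelow G u v i).ncard : ℝ) < N ∧ 3 * m ≤ (Sat G u v i).ncard := by
  classical
  have hsub : ∀ i, Sbelow G u v i ⊆ Sbelow G u v n := fun i => by
    simpa using Sbelow_subset_card G huv i
  have hTn : T ≤ ((Sbelow G u v n).ncard : ℝ) := by
    obtain ⟨i, hi⟩ := hlarge
    refine hi.trans ?_
    rw [Nat.card_coe_set_eq]
    exact_mod_cast Set.ncard_le_ncard (hsub (i + 1))
  have hSat : (Sat G u v n).ncard = 0 := by
    rw [Sat, Set.sdiff_eq_empty.2 (hsub (n + 1)), Set.ncard_empty]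
  have hn : N ≤ ((Sbelow G u v n).ncard : ℝ) := by
    by_contra! h
    have h1 := hgrow n le_rfl h
    rw [hSat] at h1
    have h2 := mul_le_mul_of_nonneg_left hTn hκ
    simp at h1
    linarith
  have hex : ∃ j, N ≤ ((Sbelow G u v j).ncard : ℝ) := ⟨n, hn⟩
  have hfind := Nat.find_spec hex
  have hmin : ∀ j < Nat.find hex, ((Sbelow G u v j).ncard : ℝ) < N := fun j hj =>
    not_le.1 (Nat.find_min hex hj)
  have hfn : Nat.find hex ≤ n := Nat.find_min' hex hn
  obtain ⟨i, hi⟩ : ∃ i, Nat.find hex = i + 1 := by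
    refine Nat.exists_eq_succ_of_ne_zero fun h0 => ?_
    rw [h0] at hfind
    have : Sbelow G u v 0 = ∅ := by
      ext w
      simp [Sbelow]
    rw [this, Set.ncard_empty] at hfind
    norm_num at hfind
    linarith
  rw [hi, ncard_Sbelow_succ] at hfind
  have hlt := hmin i (by omega)
  refine ⟨i, by omega, hlt, ?_⟩
  have hg := hgrow i (by omega) hlt
  push_cast at hfind
  by_contra! h
  have h' : ((Sat G u v i).ncard : ℝ) < 3 * m := by exact_mod_cast h
  have h3 : N / 2 ≤ (Sbelow G u v i).ncard := by linarith
  have h4 := mul_le_mul_of_nonneg_left h3 hκ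
  have h5 := mul_le_mul_of_nonneg_left h'.le hθ.le
  linarith

lemma bernoulliProb_exists_indistinguishable_le {p q L θ κ N t T : ℝ} (h0 : 0 ≤ p) (h1 : p ≤ 1)
    (hθ : 0 < θ) (hκ : 0 ≤ κ) (hN0 : 0 < N) (hNn : N ≤ n) (hNp : N * p ≤ 1)
    (hpar : θ + κ ≤ (1 - Real.exp (-θ)) * ((n - N) * p * (1 - N * p))) (hT : t ≤ κ * T)
    {m M : ℕ} (hm : θ * (3 * m) ≤ κ * (N / 2) - t) (hm' : (3 * m : ℝ) ≤ N / 2)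
    (hM : N + 3 * m + 12 * M ≤ n) (hq0 : 0 ≤ q) (hL : 0 < L) (hLm : L ≤ q ^ 3 * m / 4608)
    (hslot : q ≤ (2 * M : ℕ) * p * (1 - p) ^ (2 * M - 1))
    (hrest : ∀ b ≤ 21, q ≤ M.choose b * p ^ b * (1 - p) ^ (M - b))
    (G₀ : SimpleGraph (Fin n)) :
    bernoulliProb p (fun f => ¬ ∀ u v : Fin n, u ≠ v →
      (∃ i : ℕ, T ≤ (Nat.card ↥(Sle (noisyGraph G₀ f) u v i) : ℝ)) →
        ¬ crStableTrivial (noisyGraph G₀ f) u v) ≤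
      n ^ 2 * (n + 1) * (Real.exp (-t) + 193 / L ^ 4) := by
  classical
  let slow : (Fin n × Fin n) × ℕ → (Sym2 (Fin n) → Bool) → Prop := fun x f => x.1.1 ≠ x.1.2 ∧
    ((Sbelow (noisyGraph G₀ f) x.1.1 x.1.2 x.2).ncard : ℝ) < N ∧
    t ≤ κ * (Sbelow (noisyGraph G₀ f) x.1.1 x.1.2 x.2).ncard -
      θ * (Sat (noisyGraph G₀ f) x.1.1 x.1.2 x.2).ncard
  let stuck : (Fin n × Fin n) × ℕ → (Sym2 (Fin n) → Bool) → Prop := fun x f => x.1.1 ≠ x.1.2 ∧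
    crStableTrivial (noisyGraph G₀ f) x.1.1 x.1.2 ∧
      3 * m ≤ (Sat (noisyGraph G₀ f) x.1.1 x.1.2 x.2).ncard ∧
      (Sbelow (noisyGraph G₀ f) x.1.1 x.1.2 x.2).ncard + 3 * m + 12 * M ≤ n
  let s : Finset ((Fin n × Fin n) × ℕ) := Finset.univ ×ˢ Finset.range (n + 1)
  have hle : ∀ f, (¬ ∀ u v : Fin n, u ≠ v →
      (∃ i : ℕ, T ≤ (Nat.card ↥(Sle (noisyGraph G₀ f) u v i) : ℝ)) →
        ¬ crStableTrivial (noisyGraph G₀ f) u v) → ∃ x ∈ s, slow x f ∨ stuck x f := by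
    intro f hf
    push Not at hf
    obtain ⟨u, v, huv, hlarge, hcr⟩ := hf
    by_cases hgrow : ∀ i ≤ n, ((Sbelow (noisyGraph G₀ f) u v i).ncard : ℝ) < N →
      κ * (Sbelow (noisyGraph G₀ f) u v i).ncard - θ * (Sat (noisyGraph G₀ f) u v i).ncard < t
    · obtain ⟨i, hi, hlt, h3⟩ :=
        exists_large_layer hκ hN0 hT hθ hm hm' _ huv hgrow hlarge
      refine ⟨((u, v), i), by simp [s]; omega, Or.inr ⟨huv, hcr, h3, ?_⟩⟩
      have : ((Sbelow (noisyGraph G₀ f) u v i).ncard : ℝ) + 3 * m + 12 * M ≤ n := by linarith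
      exact_mod_cast this
    · push Not at hgrow
      obtain ⟨i, hi, hlt, h3⟩ := hgrow
      exact ⟨((u, v), i), by simp [s]; omega, Or.inl ⟨huv, hlt, h3⟩⟩
  have hpos : (0 : ℝ) ≤ 193 / L ^ 4 := by positivity
  have hone : ∀ x ∈ s, bernoulliProb p (fun f => slow x f ∨ stuck x f) ≤
      Real.exp (-t) + 193 / L ^ 4 := by
    intro x _
    refine (bernoulliProb_or_le h0 h1 _ _).trans (add_le_add ?_ ?_)
    · by_cases huv : x.1.1 = x.1.2
      · refine (bernoulliExp_le_const h0 h1 fun f => ?_).trans (Real.exp_pos _).le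
        rw [if_neg fun h => h.1 huv]
      · exact (bernoulliProb_mono h0 h1 fun f h => h.2).trans
          (bernoulliProb_slow_growth_le h0 h1 G₀ huv hθ.le hNn hNp hpar t x.2)
    · by_cases huv : x.1.1 = x.1.2
      · refine (bernoulliExp_le_const h0 h1 fun f => ?_).trans hpos
        rw [if_neg fun h => h.1 huv]
      · exact (bernoulliProb_mono h0 h1 fun f h => h.2).trans
          (bernoulliProb_crStableTrivial_large_layer_le h0 h1 hq0 hL hLm hslot hrest G₀ huv x.2)
  refine (bernoulliProb_mono h0 h1 hle).trans ((bernoulliProb_exists_le h0 h1 s _).trans ?_)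
  refine (Finset.sum_le_sum hone).trans (le_of_eq ?_)
  have hs : s.card = n ^ 2 * (n + 1) := by
    simp [s, sq]
  rw [Finset.sum_const, nsmul_eq_mul, hs]
  push_cast
  ring

end UnionBound

section Measure

open scoped ENNReal

lemma erdosRenyiMeasure_apply {n : ℕ} {p : ℝ} (h0 : 0 ≤ p) (h1 : p ≤ 1)
    (S : Set (Sym2 (Fin n) → Bool)) :
    erdosRenyiMeasure n p S = ENNReal.ofReal (bernoulliProb p fun f => f ∈ S) := by
  classical
  have hw : ∀ f : Sym2 (Fin n) → Bool,
      (∏ i : Sym2 (Fin n), if f i then ENNReal.ofReal p else ENNReal.ofReal (1 - p)) =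
        ENNReal.ofReal (bernoulliWeight p f) := by
    intro f
    rw [bernoulliWeight, ENNReal.ofReal_prod_of_nonneg]
    · exact Finset.prod_congr rfl fun i _ => by split_ifs <;> rfl
    · intro i _
      split_ifs <;> linarith
  rw [bernoulliProb_eq, bernoulliExp, ENNReal.ofReal_sum_of_nonneg]
  · simp only [erdosRenyiMeasure, bernoulliProduct, Measure.coe_finsetSum, Finset.sum_apply,
      Measure.smul_apply, Measure.dirac_apply, smul_eq_mul, hw]
    refine Finset.sum_congr rfl fun f _ => ?_
    by_cases hf : f ∈ S <;> simp [hf]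
  · intro f _
    exact mul_nonneg (bernoulliWeight_nonneg h0 h1 f) (by split_ifs <;> simp)

lemma one_sub_bernoulliProb_not {ι : Type*} [Fintype ι] [DecidableEq ι] {p : ℝ}
    (P : (ι → Bool) → Prop) :
    1 - bernoulliProb p (fun f => ¬ P f) = bernoulliProb p P := by
  classical
  rw [sub_eq_iff_eq_add, bernoulliProb_eq p P, bernoulliProb_eq p fun f => ¬ P f,
    ← bernoulliExp_add]
  refine (bernoulliExp_const (ι := ι) p 1).symm.trans (congrArg (bernoulliExp p) ?_)
  funext f
  by_cases h : P f <;> simp [h]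

lemma tendsto_erdosRenyiMeasure {p : ℕ → ℝ} (h0 : ∀ n, 0 ≤ p n) (h1 : ∀ n, p n ≤ 1)
    (S : (n : ℕ) → Set (Sym2 (Fin n) → Bool)) (δ : ℕ → ℝ) (hδ : Tendsto δ atTop (nhds 0))
    (hS : ∀ᶠ n in atTop, bernoulliProb (p n) (fun f => f ∉ S n) ≤ δ n) :
    Tendsto (fun n => erdosRenyiMeasure n (p n) (S n)) atTop (nhds 1) := by
  simp only [erdosRenyiMeasure_apply (h0 _) (h1 _)]
  rw [← ENNReal.ofReal_one]
  refine ENNReal.tendsto_ofReal ?_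
  simp only [← one_sub_bernoulliProb_not (p := p _) (fun f => f ∈ S _)]
  have hz : Tendsto (fun n => bernoulliProb (p n) fun f => f ∉ S n) atTop (nhds 0) :=
    squeeze_zero' (Eventually.of_forall fun n => bernoulliProb_nonneg (h0 n) (h1 n) _) hS hδ
  simpa using hz.const_sub 1

end Measure

section Parameters

/-- The lower bound for the probability of the degree patterns in a gadget. -/
noncomputable def patternBound : ℝ := (1 / 100) ^ 21 / (Nat.factorial 21 : ℕ) / 2

lemma patternBound_pos : 0 < patternBound := by
  unfold patternBound
  positivity

lemma one_div_two_le_one_sub_pow {p : ℝ} (h1 : p ≤ 1) (k : ℕ) (hk : k * p ≤ 1 / 2) :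
    1 / 2 ≤ (1 - p) ^ k := by
  have h := one_add_mul_le_pow (a := -p) (by linarith) k
  rw [← sub_eq_add_neg] at h
  linarith

lemma patternBound_le {p : ℝ} (h0 : 0 < p) (h1 : p ≤ 1 / 2400) {M : ℕ}
    (hM : M = ⌊1 / (24 * p)⌋₊) :
    patternBound ≤ (2 * M : ℕ) * p * (1 - p) ^ (2 * M - 1) ∧
      ∀ b ≤ 21, patternBound ≤ M.choose b * p ^ b * (1 - p) ^ (M - b) := by
  have hinv : 1 / (24 * p) * p = 1 / 24 := by field_simp
  have hMle : (M : ℝ) * p ≤ 1 / 24 := by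
    rw [← hinv, hM]
    gcongr
    exact Nat.floor_le (by positivity)
  have hMge : 1 / 50 ≤ (M : ℝ) * p := by
    have h2 : 1 / (24 * p) - 1 < M := hM ▸ Nat.sub_one_lt_floor _
    have h3 := mul_lt_mul_of_pos_right h2 h0
    rw [sub_mul, hinv] at h3
    linarith
  have hM42 : 42 ≤ M := by
    have : (42 : ℝ) ≤ M := by
      by_contra! h
      nlinarith
    exact_mod_cast this
  have hpow : ∀ k ≤ 2 * M, 1 / 2 ≤ (1 - p) ^ k := by
    intro k hk
    refine one_div_two_le_one_sub_pow (by linarith) k ?_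
    have : (k : ℝ) ≤ 2 * M := by exact_mod_cast hk
    nlinarith
  have hfac : (1 : ℝ) ≤ (Nat.factorial 21 : ℕ) := by exact_mod_cast Nat.factorial_pos 21
  constructor
  · have h2 := hpow (2 * M - 1) (Nat.sub_le _ _)
    have hq : patternBound ≤ 1 / 50 := by
      unfold patternBound
      rw [div_div, div_le_iff₀ (by positivity)]
      norm_num at hfac ⊢
    push_cast
    nlinarith
  · intro b hb
    have h2 := hpow (M - b) ((Nat.sub_le _ _).trans (by omega))
    have h3 := Nat.pow_le_choose (α := ℝ) b M
    have h4 : (M : ℝ) / 2 ≤ ((M + 1 - b : ℕ) : ℝ) := by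
      rw [Nat.cast_sub (by omega)]
      push_cast
      have : (b : ℝ) ≤ 21 := by exact_mod_cast hb
      have : (42 : ℝ) ≤ M := by exact_mod_cast hM42
      linarith
    have h5 : (1 / 100 : ℝ) ^ 21 / (Nat.factorial 21 : ℕ) ≤ M.choose b * p ^ b := by
      calc (1 / 100 : ℝ) ^ 21 / (Nat.factorial 21 : ℕ) ≤ (1 / 100) ^ b / (Nat.factorial b : ℕ) := by
            gcongr ?_ / ?_
            · exact pow_le_pow_of_le_one (by norm_num) (by norm_num) hb
            · exact_mod_cast Nat.factorial_le hb
        _ ≤ (M / 2 * p) ^ b / (Nat.factorial b : ℕ) := by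
            gcongr
            linarith
        _ = (M / 2) ^ b / (Nat.factorial b : ℕ) * p ^ b := by rw [mul_pow]; ring
        _ ≤ ((M + 1 - b : ℕ) : ℝ) ^ b / (Nat.factorial b : ℕ) * p ^ b := by gcongr
        _ ≤ M.choose b * p ^ b := by
            gcongr
    calc patternBound = (1 / 100 : ℝ) ^ 21 / (Nat.factorial 21 : ℕ) * (1 / 2) := by
          unfold patternBound; ring
      _ ≤ _ := by gcongr

lemma one_sub_exp_neg_ge {θ : ℝ} (h : 0 ≤ θ) : θ - θ ^ 2 / 2 ≤ 1 - Real.exp (-θ) := by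
  have h1 := Real.quadratic_le_exp_of_nonneg h
  have h2 : Real.exp (-θ) * Real.exp θ = 1 := by rw [← Real.exp_add]; simp
  have h3 := Real.exp_pos (-θ)
  have h4 : Real.exp (-θ) * (1 + θ + θ ^ 2 / 2) ≤ 1 := by
    calc _ ≤ Real.exp (-θ) * Real.exp θ := by gcongr
      _ = 1 := h2
  have h5 : 1 ≤ (1 - θ + θ ^ 2 / 2) * (1 + θ + θ ^ 2 / 2) := by nlinarith [sq_nonneg (θ ^ 2)]
  have h6 : 0 < 1 + θ + θ ^ 2 / 2 := by positivity
  have := le_of_mul_le_mul_right (h4.trans h5) h6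
  linarith

lemma growth_parameters {ε θ κ D : ℝ} (hε0 : 0 ≤ ε) (hε1 : ε ≤ 1) (hθ : θ = ε / 3)
    (hκ : κ = ε ^ 2 / 12) (hD : 1 + ε / 2 ≤ D) : θ + κ ≤ (1 - Real.exp (-θ)) * D := by
  have h1 := one_sub_exp_neg_ge (θ := θ) (by rw [hθ]; positivity)
  have h2 : 0 ≤ θ - θ ^ 2 / 2 := by
    subst hθ
    nlinarith
  calc θ + κ ≤ (θ - θ ^ 2 / 2) * (1 + ε / 2) := by
        subst hθ hκ
        nlinarith [mul_nonneg (sq_nonneg ε) (sub_nonneg.2 hε1)]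
    _ ≤ _ := mul_le_mul h1 hD (by positivity) (h2.trans h1)

end Parameters

section Asymptotics

set_option maxHeartbeats 1000000 in
lemma bernoulliProb_exists_indistinguishable_le_of_large {n : ℕ} {p : ℝ}
    (hlog : 3 ≤ Real.log n) (hn : Real.log n ^ 140 ≤ n)
    (hlb : (1 + (Real.log n ^ 40)⁻¹) / n ≤ p) (hub : p ≤ 100 * Real.log n / n)
    (G₀ : SimpleGraph (Fin n)) :
    bernoulliProb p (fun f => ¬ ∀ u v : Fin n, u ≠ v →
      (∃ i : ℕ, 100 * Real.log n / min ((n * p - 1) ^ 2) 1 ≤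
        (Nat.card ↥(Sle (noisyGraph G₀ f) u v i) : ℝ)) →
        ¬ crStableTrivial (noisyGraph G₀ f) u v) ≤
      2 / n + 2 * 193 * (9216 / patternBound ^ 3) ^ 4 * Real.log n ^ 400 / n := by
  obtain ⟨l, hl⟩ : ∃ l, l = Real.log n := ⟨_, rfl⟩
  obtain ⟨x, hx⟩ : ∃ x : ℝ, x = n := ⟨_, rfl⟩
  obtain ⟨a, ha⟩ : ∃ a, a = (l ^ 10)⁻¹ := ⟨_, rfl⟩
  rw [← hl] at hlog hn hlb hub
  rw [← hx] at hn hlb hub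
  have hl0 : 0 < l := by linarith
  have ha0 : 0 < a := by rw [ha]; positivity
  have hal : a * l ^ 10 = 1 := by rw [ha]; field_simp
  have hl9 : 19683 ≤ l ^ 9 := by
    calc (19683 : ℝ) = 3 ^ 9 := by norm_num
      _ ≤ _ := by gcongr
  have hal1 : 19683 * l * a ≤ 1 := by
    calc 19683 * l * a ≤ l ^ 9 * l * a := by gcongr
      _ = 1 := by rw [← hal]; ring
  have ha1 : a ≤ 1 / 59049 := by nlinarith
  have hxa : 1 ≤ x * a ^ 14 := by
    calc 1 = l ^ 140 * a ^ 14 := by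
          rw [show l ^ 140 * a ^ 14 = (a * l ^ 10) ^ 14 by ring, hal, one_pow]
      _ ≤ _ := by gcongr
  have hx0 : 0 < x := lt_of_lt_of_le (by positivity) hn
  have ha4 : (l ^ 40)⁻¹ = a ^ 4 := by rw [ha, inv_pow, ← pow_mul]
  rw [ha4, div_le_iff₀ hx0] at hlb
  rw [le_div_iff₀ hx0] at hub
  have hp0 : 0 < p := by
    by_contra! h
    have : 0 < a ^ 4 := by positivity
    nlinarith
  obtain ⟨ε, hε⟩ : ∃ ε, ε = min (x * p - 1) 1 := ⟨_, rfl⟩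
  have hεa : a ^ 4 ≤ ε := by
    rw [hε]
    refine le_min (by linarith) (pow_le_one₀ ha0.le (by linarith))
  have hε0 : 0 < ε := lt_of_lt_of_le (by positivity) hεa
  have hε1 : ε ≤ 1 := hε ▸ min_le_right _ _
  have hεp : 1 + ε ≤ x * p := by
    have : ε ≤ x * p - 1 := hε ▸ min_le_left _ _
    linarith
  have hε2 : min ((x * p - 1) ^ 2) 1 = ε ^ 2 := by
    rw [hε]
    rcases le_total (x * p - 1) 1 with h | h
    · rw [min_eq_left h, min_eq_left (pow_le_one₀ (by linarith) h)]
    · rw [min_eq_right h, min_eq_right (one_le_pow₀ h), one_pow]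
  obtain ⟨μ, hμ⟩ : ∃ μ, μ = x * a ^ 10 := ⟨_, rfl⟩
  have ha_le : ∀ k, a ^ (k + 1) ≤ a ^ k / 59049 := fun k => by
    rw [pow_succ]
    have : 0 < a ^ k := by positivity
    nlinarith
  have hμ1 : 59049 ≤ μ := by
    have h := ha_le 13
    have h2 : a ^ 13 ≤ a ^ 10 := pow_le_pow_of_le_one ha0.le (by linarith) (by norm_num)
    nlinarith
  have hm1 : (⌊μ⌋₊ : ℝ) ≤ μ := Nat.floor_le (by linarith)
  have hm2 : μ / 2 ≤ ⌊μ⌋₊ := by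
    have := Nat.lt_floor_add_one μ
    linarith
  have hp1 : p ≤ 1 / 2400 := by
    have h2 : a ^ 14 ≤ a ^ 2 := pow_le_pow_of_le_one ha0.le (by linarith) (by norm_num)
    have h3 : 1 ≤ x * a ^ 2 := hxa.trans (by gcongr)
    have h4 : 100 * l ≤ x / 2400 := by
      calc 100 * l ≤ 100 * l * (x * a ^ 2) := le_mul_of_one_le_right (by positivity) h3
        _ = x * (100 * (l * a) * a) := by ring
        _ ≤ x * (100 * (1 / 19683) * (1 / 59049)) := by
          gcongr
          linarith
        _ ≤ x / 2400 := by linarith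
    nlinarith
  have hM : (⌊1 / (24 * p)⌋₊ : ℝ) ≤ x / 24 := by
    refine (Nat.floor_le (by positivity)).trans ?_
    rw [div_le_div_iff₀ (by positivity) (by norm_num)]
    linarith
  have ha5 : a ^ 5 ≤ a ^ 4 / 59049 := ha_le 4
  have hN0 : 0 < x * a ^ 5 := by positivity
  have hNε : a ^ 5 ≤ ε / 8 := by linarith
  have hNp : x * a ^ 5 * p ≤ ε / 8 := by
    calc x * a ^ 5 * p = p * x * a ^ 5 := by ring
      _ ≤ 100 * l * a ^ 5 := by gcongr
      _ = 100 * (l * a) * a ^ 4 := by ring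
      _ ≤ 100 * (1 / 19683) * ε := by
        gcongr
        linarith
      _ ≤ ε / 8 := by linarith
  have hμN : μ ≤ ε * (x * a ^ 5) / 59049 := by
    calc μ = x * a ^ 5 * a ^ 5 := by rw [hμ]; ring
      _ ≤ x * a ^ 5 * (ε / 59049) := by
        gcongr
        linarith
      _ = _ := by ring
  have hlN : 19683 * l ≤ ε ^ 2 * (x * a ^ 5) := by
    calc 19683 * l ≤ 19683 * l * (x * a ^ 14) := le_mul_of_one_le_right (by positivity) hxa
      _ = 19683 * l * a * (x * a ^ 13) := by ring
      _ ≤ 1 * (x * a ^ 13) := by gcongr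
      _ = (a ^ 4) ^ 2 * (x * a ^ 5) := by ring
      _ ≤ _ := by gcongr
  have hNx : x * a ^ 5 ≤ x / 8 := by nlinarith
  have hD : 1 + ε / 2 ≤ (n - x * a ^ 5) * p * (1 - x * a ^ 5 * p) := by
    have h8 : 0 ≤ 1 - ε / 8 := by linarith
    rw [← hx]
    calc 1 + ε / 2 ≤ (1 + ε) * (1 - ε / 8) * (1 - ε / 8) := by
          nlinarith [mul_nonneg hε0.le (sub_nonneg.2 hε1), pow_pos hε0 3]
      _ ≤ x * p * (1 - a ^ 5) * (1 - x * a ^ 5 * p) := by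
        gcongr
        linarith
      _ = _ := by ring
  have hm0 : 0 < (⌊μ⌋₊ : ℝ) := by linarith
  have hL0 : 0 < patternBound ^ 3 * ⌊μ⌋₊ / 4608 :=
    div_pos (mul_pos (pow_pos patternBound_pos 3) hm0) (by norm_num)
  have key := bernoulliProb_exists_indistinguishable_le (T := 100 * l / ε ^ 2) (t := 4 * l)
    hp0.le (by linarith) (by positivity : 0 < ε / 3) (by positivity : 0 ≤ ε ^ 2 / 12) hN0
    (by rw [← hx]; linarith) (by linarith) (growth_parameters hε0.le hε1 rfl rfl hD)
    (by field_simp; linarith) (m := ⌊μ⌋₊) (by nlinarith) (by nlinarith)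
    (by rw [← hx]; nlinarith) patternBound_pos.le hL0 le_rfl
    (patternBound_le hp0 hp1 rfl).1 (patternBound_le hp0 hp1 rfl).2 G₀
  rw [← hl, ← hx, hε2]
  refine key.trans ?_
  rw [← hx]
  have hc : 0 < patternBound ^ 3 := pow_pos patternBound_pos 3
  generalize patternBound ^ 3 = c at hc hL0 ⊢
  have hexp : Real.exp (-(4 * l)) = (x ^ 4)⁻¹ := by
    rw [Real.exp_neg, hl, hx, ← Real.exp_log (hx ▸ hx0 : (0 : ℝ) < n), ← Real.exp_nat_mul,
      Real.log_exp]
    norm_num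
  have hL : 193 / (c * ⌊μ⌋₊ / 4608) ^ 4 ≤ 193 * (9216 / c) ^ 4 * l ^ 400 / x ^ 4 := by
    calc 193 / (c * ⌊μ⌋₊ / 4608) ^ 4 ≤ 193 / (c * (μ / 2) / 4608) ^ 4 := by gcongr
      _ = 193 * (9216 / c) ^ 4 * (l ^ 400 / x ^ 4) := by
        rw [hμ, ha]
        field_simp
        norm_num
      _ = _ := by ring
  have hx1 : 1 ≤ x := le_trans (one_le_pow₀ (by linarith)) hn
  calc x ^ 2 * (x + 1) * (Real.exp (-(4 * l)) + 193 / (c * ⌊μ⌋₊ / 4608) ^ 4)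
      ≤ x ^ 2 * (x + x) * ((x ^ 4)⁻¹ + 193 * (9216 / c) ^ 4 * l ^ 400 / x ^ 4) := by
        rw [hexp]
        gcongr
    _ = _ := by
      field_simp
      ring

lemma tendsto_div_add_const_mul_log_pow_div (C : ℝ) (k : ℕ) :
    Tendsto (fun n : ℕ => 2 / (n : ℝ) + C * Real.log n ^ k / n) atTop (nhds 0) := by
  have h1 : Tendsto (fun n : ℕ => 2 / (n : ℝ)) atTop (nhds 0) :=
    tendsto_const_div_atTop_nhds_zero_nat 2
  have h2 : Tendsto (fun n : ℕ => Real.log n ^ k / (n : ℝ)) atTop (nhds 0) :=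
    (Real.isLittleO_pow_log_id_atTop (n := k)).tendsto_div_nhds_zero.comp
      tendsto_natCast_atTop_atTop
  simpa [mul_div_assoc] using h1.add (h2.const_mul C)

lemma eventually_log_pow_le (k : ℕ) : ∀ᶠ n : ℕ in atTop, Real.log n ^ k ≤ n := by
  have h := ((Real.isLittleO_pow_log_id_atTop (n := k)).bound one_pos).natCast_atTop
  filter_upwards [h] with n hn
  simpa using (le_abs_self _).trans hn

end Asymptotics

/-- Proposition 4.1.
For `p = p_n ∈ [0,1/2]` with (eventually) `(1+(log n)^{-40})/n ≤ p ≤ 100·log n/n`, and any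
sequence `G₀`, whp `G = G₀ △ G_rand` has the property: for all distinct `u,v` such that
`|S^{≤i}_G({u,v})| ≥ 100 log n / min((np-1)², 1)` for some `i`, the vertices `u,v` get distinct
colours in `R*σ`. -/
theorem stmt4 (p : ℕ → ℝ) (hp0 : ∀ n, 0 ≤ p n) (hp1 : ∀ n, p n ≤ 1 / 2)
    (hlb : ∀ᶠ n : ℕ in atTop, (1 + ((Real.log n) ^ 40)⁻¹) / n ≤ p n)
    (hub : ∀ᶠ n : ℕ in atTop, p n ≤ 100 * Real.log n / n)
    (G₀ : (n : ℕ) → SimpleGraph (Fin n)) :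
    Tendsto (fun n : ℕ =>
      erdosRenyiMeasure n (p n)
        {f | ∀ u v : Fin n, u ≠ v →
          (∃ i : ℕ, 100 * Real.log n / min ((n * p n - 1) ^ 2) 1 ≤
            (Nat.card ↥(Sle (symmDiffG (G₀ n) (graphOfFlip f)) u v i) : ℝ)) →
          ¬ crStableTrivial (symmDiffG (G₀ n) (graphOfFlip f)) u v})
      atTop (nhds 1) := by
  refine tendsto_erdosRenyiMeasure hp0 (fun n => (hp1 n).trans (by norm_num)) _ _
    (tendsto_div_add_const_mul_log_pow_div (2 * 193 * (9216 / patternBound ^ 3) ^ 4) 400) ?_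
  have hlog : ∀ᶠ n : ℕ in atTop, 3 ≤ Real.log n :=
    (Real.tendsto_log_atTop.comp tendsto_natCast_atTop_atTop).eventually_ge_atTop 3
  filter_upwards [hlb, hub, hlog, eventually_log_pow_le 140] with n h1 h2 h3 h4
  exact bernoulliProb_exists_indistinguishable_le_of_large h3 h4 h1 h2 (G₀ n)
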